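/- arXiv:2605.22250 — 4 statements merged into one kernel-verified Lean document; each statement's English description precedes it below -/
import Mathlib

section
/- The quotient ring H = ℂ[A,X,Y]/(f) is a normal domain; that is, H is an integral domain that is integrally closed in its field of fractions. -/
open MvPolynomial

theorem aux_dvd {R : Type*} [CommRing R] [IsDomain R] [UniqueFactorizationMonoid R]
    {d q r : R} (hd : Squarefree d) (hr : r ≠ 0) (h : r * r ∣ q * q * d) : r ∣ q := by
  obtain ⟨r', q', c, hrel, rfl, rfl⟩ := UniqueFactorizationMonoid.exists_reduced_factors r hr q
  have hc : c ≠ 0 := left_ne_zero_of_mul hr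
  have h1 : (c * c) * (r' * r') ∣ (c * c) * (q' * q' * d) := by
    convert h using 1 <;> ring
  have h2 : r' * r' ∣ q' * q' * d := (mul_dvd_mul_iff_left (mul_ne_zero hc hc)).mp h1
  have h3 : IsRelPrime (r' * r') (q' * q') := by
    apply IsRelPrime.mul_left <;> apply IsRelPrime.mul_right <;> exact hrel
  have h4 : r' * r' ∣ d := h3.dvd_of_dvd_mul_left h2
  have hu : IsUnit r' := hd r' h4
  exact mul_dvd_mul_left c hu.dvd

theorem aux_sq {R : Type*} [CommRing R] [IsDomain R] [UniqueFactorizationMonoid R]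
    {d p q : R} (hd : Squarefree d) (hu : ¬ IsUnit d) (h : p * p = q * q * d) : q = 0 := by
  by_contra hq
  have h1 : q * q ∣ p * p * 1 := ⟨d, by rw [mul_one, h]⟩
  obtain ⟨m, rfl⟩ := aux_dvd squarefree_one hq h1
  have h2 : m * m = d := by
    apply mul_left_cancel₀ (mul_ne_zero hq hq)
    rw [← h]; ring
  have := hd m ⟨1, by rw [mul_one, h2]⟩
  exact hu (h2 ▸ this.mul this)

theorem aux_domain {R S : Type*} [CommRing R] [IsDomain R] [UniqueFactorizationMonoid R]
    [CommRing S] [Algebra R S] {d : R} (hd : Squarefree d) (hu : ¬ IsUnit d)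
    (a : S) (ha : a * a = algebraMap R S d)
    (hex : ∀ s : S, ∃ p q : R, s = algebraMap R S p + algebraMap R S q * a)
    (hun : ∀ p q : R, algebraMap R S p + algebraMap R S q * a = 0 → p = 0 ∧ q = 0) :
    IsDomain S := by
  have : Nontrivial S := ⟨⟨1, 0, fun h => one_ne_zero (hun 1 0 (by simpa using h)).1⟩⟩
  have : NoZeroDivisors S := by
    refine ⟨fun {z w} h => ?_⟩
    obtain ⟨p, q, rfl⟩ := hex z
    obtain ⟨p', q', rfl⟩ := hex w
    have key : algebraMap R S ((p * p - q * q * d) * p') +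
        algebraMap R S ((p * p - q * q * d) * q') * a = 0 := by
      simp only [map_mul, map_sub, ← ha]
      linear_combination (algebraMap R S p - algebraMap R S q * a) * h
    obtain ⟨h1, h2⟩ := hun _ _ key
    by_cases hN : p * p - q * q * d = 0
    · left
      have hq : q = 0 := aux_sq hd hu (sub_eq_zero.mp hN)
      subst hq
      have hp : p = 0 := by simpa using hN
      simp [hp]
    · right
      have hp' : p' = 0 := (mul_eq_zero.mp h1).resolve_left hN
      have hq' : q' = 0 := (mul_eq_zero.mp h2).resolve_left hN
      simp [hp', hq']
  exact NoZeroDivisors.to_isDomain S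

theorem aux_closed {R S : Type*} [CommRing R] [IsDomain R] [UniqueFactorizationMonoid R]
    [CommRing S] [IsDomain S] [Algebra R S] {d : R} (h2 : IsUnit (2 : R))
    (hd : Squarefree d) (hu : ¬ IsUnit d)
    (a : S) (ha : a * a = algebraMap R S d)
    (hex : ∀ s : S, ∃ p q : R, s = algebraMap R S p + algebraMap R S q * a)
    (hun : ∀ p q : R, algebraMap R S p + algebraMap R S q * a = 0 → p = 0 ∧ q = 0) :
    IsIntegrallyClosed S := by
  rw [isIntegrallyClosed_iff (FractionRing S)]
  intro z hz
  have hinj : Function.Injective (algebraMap R S) := by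
    rw [injective_iff_map_eq_zero]
    intro x hx
    exact (hun x 0 (by simpa using hx)).1
  have hinjS : Function.Injective (algebraMap S (FractionRing S)) :=
    IsFractionRing.injective S (FractionRing S)
  have hinjK : Function.Injective (algebraMap R (FractionRing S)) := by
    rw [IsScalarTower.algebraMap_eq R S (FractionRing S)]
    exact hinjS.comp hinj
  have : FaithfulSMul R (FractionRing S) := (faithfulSMul_iff_algebraMap_injective _ _).mpr hinjK
  have : Module.IsTorsionFree R (FractionRing S) := inferInstance
  have hintS : Algebra.IsIntegral R S := by
    refine ⟨fun s => ?_⟩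
    obtain ⟨p, q, rfl⟩ := hex s
    have hia : IsIntegral R a := by
      apply IsIntegral.of_pow (n := 2) (by norm_num)
      rw [pow_two, ha]; exact isIntegral_algebraMap
    exact isIntegral_algebraMap.add (isIntegral_algebraMap.mul hia)
  have hzR : IsIntegral R z := isIntegral_trans z hz
  -- common denominator in R
  obtain ⟨p, q, r, hr, hzr⟩ : ∃ p q r : R, r ≠ 0 ∧ algebraMap R (FractionRing S) r * z =
      algebraMap S _ (algebraMap R S p + algebraMap R S q * a) := by
    obtain ⟨u, v, hv, rfl⟩ := IsFractionRing.div_surjective (A := S) z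
    have hv0 : v ≠ 0 := nonZeroDivisors.ne_zero hv
    obtain ⟨v1, v2, rfl⟩ := hex v
    obtain ⟨p, q, hpq⟩ := hex (u * (algebraMap R S v1 - algebraMap R S v2 * a))
    refine ⟨p, q, v1 * v1 - v2 * v2 * d, fun h0 => ?_, ?_⟩
    · have hq : v2 = 0 := aux_sq hd hu (sub_eq_zero.mp h0)
      subst hq
      have hp : v1 = 0 := by simpa using h0
      simp [hp] at hv0
    · have hvK : algebraMap S (FractionRing S) (algebraMap R S v1 + algebraMap R S v2 * a) ≠ 0 :=
        fun h => hv0 (hinjS (by simpa using h))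
      rw [← hpq, IsScalarTower.algebraMap_apply R S (FractionRing S), mul_div_assoc',
        div_eq_iff hvK, ← map_mul, ← map_mul]
      congr 1
      simp only [map_mul, map_sub, ← ha]
      ring
  have hrK : algebraMap R (FractionRing S) r ≠ 0 := fun h => hr (hinjK (by simpa using h))
  suffices hs : r ∣ p ∧ r ∣ q by
    obtain ⟨⟨p', rfl⟩, ⟨q', rfl⟩⟩ := hs
    refine ⟨algebraMap R S p' + algebraMap R S q' * a, ?_⟩
    apply mul_left_cancel₀ hrK
    rw [hzr, IsScalarTower.algebraMap_apply R S (FractionRing S), ← map_mul]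
    congr 1
    simp only [map_mul]; ring
  have hsq : (algebraMap R (FractionRing S) r * z - algebraMap R (FractionRing S) p) ^ 2 =
      algebraMap R (FractionRing S) (q * q * d) := by
    rw [hzr]
    simp only [IsScalarTower.algebraMap_apply R S (FractionRing S)]
    rw [← map_sub, ← map_pow]
    congr 1
    simp only [map_mul, ← ha]; ring
  by_cases hq : q = 0
  · subst hq
    refine ⟨?_, dvd_zero _⟩
    have hsq' : algebraMap R (FractionRing S) r * z - algebraMap R (FractionRing S) p = 0 := by
      simpa using hsq
    have hdeg : (Polynomial.C r * Polynomial.X + Polynomial.C (-p)).degree = 1 :=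
      Polynomial.degree_linear hr
    have hl : (Polynomial.C r * Polynomial.X + Polynomial.C (-p)).leadingCoeff = r :=
      Polynomial.leadingCoeff_linear hr
    have h := (minpoly.IsIntegrallyClosed.isIntegral_iff_leadingCoeff_dvd (R := R) (s := z)
      (p := Polynomial.C r * Polynomial.X + Polynomial.C (-p)) (by
        simpa [sub_eq_add_neg] using hsq')
      (by intro h; rw [h] at hdeg; simp at hdeg)
      (by
        intro Q hQ hQz
        rw [hdeg]
        by_contra hlt
        have : Q = 1 := by
          apply hQ.natDegree_eq_zero.mp
          have h1 := Polynomial.natDegree_lt_iff_degree_lt hQ.ne_zero (n := 1)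
          have := h1.mpr (by simpa using hlt)
          omega
        simp [this] at hQz)).mp hzR
    rw [hl, Polynomial.C_dvd_iff_dvd_coeff] at h
    simpa using h 0
  · have hr2 : r * r ≠ 0 := mul_ne_zero hr hr
    have hdeg : (Polynomial.C (r * r) * Polynomial.X ^ 2 + Polynomial.C (-(2 * r * p)) * Polynomial.X
        + Polynomial.C (p * p - q * q * d)).degree = 2 := Polynomial.degree_quadratic hr2
    have hl : (Polynomial.C (r * r) * Polynomial.X ^ 2 + Polynomial.C (-(2 * r * p)) * Polynomial.X
        + Polynomial.C (p * p - q * q * d)).leadingCoeff = r * r :=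
      Polynomial.leadingCoeff_quadratic hr2
    have h := (minpoly.IsIntegrallyClosed.isIntegral_iff_leadingCoeff_dvd (R := R) (s := z)
      (p := Polynomial.C (r * r) * Polynomial.X ^ 2 + Polynomial.C (-(2 * r * p)) * Polynomial.X
        + Polynomial.C (p * p - q * q * d)) (by
        simp only [map_add, map_mul, map_pow, Polynomial.aeval_X, Polynomial.aeval_C, map_neg,
          map_sub, map_ofNat] at hsq ⊢
        linear_combination hsq)
      (by intro h; rw [h] at hdeg; simp at hdeg)
      (by
        intro Q hQ hQz
        rw [hdeg]
        by_contra hlt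
        have h1 : Q.natDegree < 2 := by
          have h1 := Polynomial.natDegree_lt_iff_degree_lt hQ.ne_zero (n := 2)
          exact h1.mpr (by simpa using hlt)
        obtain h0 | h0 : Q.natDegree = 0 ∨ Q.natDegree = 1 := by omega
        · have : Q = 1 := hQ.natDegree_eq_zero.mp h0
          simp [this] at hQz
        · have hQe := hQ.eq_X_add_C h0
          rw [hQe] at hQz
          set b := Q.coeff 0
          simp only [map_add, Polynomial.aeval_X, Polynomial.aeval_C] at hQz
          apply hq
          refine (hun (p + r * b) q ?_).2
          apply hinjS
          rw [map_zero]
          simp only [map_add, map_mul, IsScalarTower.algebraMap_apply R S (FractionRing S)]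
            at hzr hQz ⊢
          linear_combination (algebraMap S (FractionRing S) (algebraMap R S r)) * hQz - hzr)).mp hzR
    rw [hl, Polynomial.C_dvd_iff_dvd_coeff] at h
    have h0 := h 0
    have h1 := h 1
    simp only [Polynomial.coeff_add, Polynomial.coeff_C_mul, Polynomial.coeff_X_pow,
      Polynomial.coeff_X, Polynomial.coeff_C] at h0 h1
    norm_num at h0 h1
    have hrp : r ∣ p := by
      have : r * r ∣ r * (2 * p) := by
        convert h1 using 1; ring
      have := (mul_dvd_mul_iff_left hr).mp this
      exact (h2.dvd_mul_left).mp this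
    refine ⟨hrp, aux_dvd hd hr ?_⟩
    exact (dvd_sub_right (mul_dvd_mul hrp hrp)).mp h0

theorem aux_squarefree : Squarefree
    (X 0 * X 1 * ((X 0) ^ 2 - X 1) : MvPolynomial (Fin 2) ℂ) := by
  have p0 : Prime (X 0 : MvPolynomial (Fin 2) ℂ) := X_prime
  have p1 : Prime (X 1 : MvPolynomial (Fin 2) ℂ) := X_prime
  let φ : MvPolynomial (Fin 2) ℂ →ₐ[ℂ] MvPolynomial (Fin 2) ℂ := aeval ![X 0, X 0 ^ 2 - X 1]
  have hφ : φ.comp φ = AlgHom.id ℂ _ := by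
    ext i : 1
    fin_cases i <;> simp [φ]
  let e : MvPolynomial (Fin 2) ℂ ≃ₐ[ℂ] MvPolynomial (Fin 2) ℂ := AlgEquiv.ofAlgHom φ φ hφ hφ
  have he : e (X 1) = X 0 ^ 2 - X 1 := by simp [e, φ]
  have p2 : Prime (X 0 ^ 2 - X 1 : MvPolynomial (Fin 2) ℂ) := by
    rw [← he]
    exact (MulEquiv.prime_iff (e : MvPolynomial (Fin 2) ℂ ≃* MvPolynomial (Fin 2) ℂ)).mpr p1
  have n1 : ¬ (X 0 : MvPolynomial (Fin 2) ℂ) ∣ X 1 := by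
    intro h
    have := map_dvd (eval ![0, 1]) h
    simp at this
  have n2 : ¬ (X 0 : MvPolynomial (Fin 2) ℂ) ∣ X 0 ^ 2 - X 1 := by
    intro h
    have := map_dvd (eval ![0, 1]) h
    simp at this
  have n3 : ¬ (X 1 : MvPolynomial (Fin 2) ℂ) ∣ X 0 ^ 2 - X 1 := by
    intro h
    have := map_dvd (eval ![1, 0]) h
    simp at this
  rw [squarefree_mul_iff, squarefree_mul_iff]
  refine ⟨IsRelPrime.mul_left ?_ ?_, ⟨?_, p0.irreducible.squarefree, p1.irreducible.squarefree⟩,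
    p2.irreducible.squarefree⟩
  · exact p0.irreducible.isRelPrime_iff_not_dvd.mpr n2
  · exact p1.irreducible.isRelPrime_iff_not_dvd.mpr n3
  · exact p0.irreducible.isRelPrime_iff_not_dvd.mpr n1

theorem aux_adjoin {R : Type*} [CommRing R] [IsDomain R] [UniqueFactorizationMonoid R]
    {d : R} (h2 : IsUnit (2 : R)) (hd : Squarefree d) (hu : ¬ IsUnit d) :
    IsDomain (AdjoinRoot (Polynomial.X ^ 2 - Polynomial.C d)) ∧
    IsIntegrallyClosed (AdjoinRoot (Polynomial.X ^ 2 - Polynomial.C d)) := by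
  set g : Polynomial R := Polynomial.X ^ 2 - Polynomial.C d with hg
  have hm : g.Monic := Polynomial.monic_X_pow_sub_C d (by norm_num)
  have hdeg : g.degree = 2 := Polynomial.degree_X_pow_sub_C (by norm_num) d
  have ha : AdjoinRoot.root g * AdjoinRoot.root g = algebraMap R _ d := by
    have : AdjoinRoot.mk g g = 0 := AdjoinRoot.mk_self
    conv at this => lhs; arg 2; rw [hg]
    simp only [map_sub, map_pow, AdjoinRoot.mk_X, AdjoinRoot.mk_C] at this
    rw [← pow_two, sub_eq_zero.mp this]; rfl
  have hex : ∀ s : AdjoinRoot g, ∃ p q : R,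
      s = algebraMap R _ p + algebraMap R _ q * AdjoinRoot.root g := by
    intro s
    have h1 := AdjoinRoot.mk_leftInverse hm s
    obtain ⟨f, rfl⟩ := AdjoinRoot.mk_surjective s
    rw [AdjoinRoot.modByMonicHom_mk] at h1
    have hlt := Polynomial.degree_modByMonic_lt f hm
    rw [hdeg] at hlt
    have hle : (f %ₘ g).degree ≤ 1 := by
      have h5 : (f %ₘ g).natDegree ≤ 1 := by
        by_cases h0 : f %ₘ g = 0
        · simp [h0]
        · have := (Polynomial.natDegree_lt_iff_degree_lt h0 (n := 2)).mpr hlt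
          omega
      exact Polynomial.degree_le_of_natDegree_le h5
    have h3 := Polynomial.eq_X_add_C_of_degree_le_one hle
    refine ⟨(f %ₘ g).coeff 0, (f %ₘ g).coeff 1, ?_⟩
    rw [← h1]
    conv_lhs => rw [h3]
    simp only [map_add, map_mul, AdjoinRoot.mk_X, AdjoinRoot.mk_C, AdjoinRoot.algebraMap_eq]
    ring
  have hun : ∀ p q : R, algebraMap R (AdjoinRoot g) p + algebraMap R _ q * AdjoinRoot.root g = 0 →
      p = 0 ∧ q = 0 := by
    intro p q h
    by_contra hne
    have h0 : Polynomial.C q * Polynomial.X + Polynomial.C p ≠ 0 := by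
      intro h0
      apply hne
      constructor
      · simpa using congrArg (fun f => Polynomial.coeff f 0) h0
      · simpa using congrArg (fun f => Polynomial.coeff f 1) h0
    refine AdjoinRoot.mk_ne_zero_of_degree_lt hm h0 ?_ ?_
    · rw [hdeg]
      exact lt_of_le_of_lt Polynomial.degree_linear_le (by norm_num)
    · simp only [map_add, map_mul, AdjoinRoot.mk_X, AdjoinRoot.mk_C]
      rw [add_comm]; exact h
  have hdom := aux_domain hd hu _ ha hex hun
  exact ⟨hdom, aux_closed h2 hd hu _ ha hex hun⟩

/-- `H = ℂ[A,X,Y]/(f)` with `f = A² − X·Y·(X² − Y)` is a normal domain: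
an integral domain which is integrally closed in its field of fractions.
Variables: `A = X 0`, `X = X 1`, `Y = X 2`. -/
theorem stmt_4 :
    IsDomain (MvPolynomial (Fin 3) ℂ ⧸
      Ideal.span {((X 0) ^ 2 - X 1 * X 2 * ((X 1) ^ 2 - X 2) :
        MvPolynomial (Fin 3) ℂ)}) ∧
    IsIntegrallyClosed (MvPolynomial (Fin 3) ℂ ⧸
      Ideal.span {((X 0) ^ 2 - X 1 * X 2 * ((X 1) ^ 2 - X 2) :
        MvPolynomial (Fin 3) ℂ)}) := by
  have h2 : IsUnit (2 : MvPolynomial (Fin 2) ℂ) := by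
    have : IsUnit (2 : ℂ) := by simp
    have h3 := this.map (C : ℂ →+* MvPolynomial (Fin 2) ℂ)
    rwa [map_ofNat] at h3
  have hu : ¬ IsUnit (X 0 * X 1 * ((X 0) ^ 2 - X 1) : MvPolynomial (Fin 2) ℂ) := by
    intro h
    have := h.map (eval ![0, 0])
    simp at this
  obtain ⟨hD, hI⟩ := aux_adjoin h2 aux_squarefree hu
  let e : (MvPolynomial (Fin 3) ℂ ⧸
      Ideal.span {((X 0) ^ 2 - X 1 * X 2 * ((X 1) ^ 2 - X 2) : MvPolynomial (Fin 3) ℂ)}) ≃+*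
      AdjoinRoot (Polynomial.X ^ 2 - Polynomial.C
        (X 0 * X 1 * ((X 0) ^ 2 - X 1) : MvPolynomial (Fin 2) ℂ)) :=
    Ideal.quotientEquiv _ _ (finSuccEquiv ℂ 2).toRingEquiv (by
      have e1 : finSuccEquiv ℂ 2 (X 1) = Polynomial.C (X 0) := finSuccEquiv_X_succ (j := 0)
      have e2 : finSuccEquiv ℂ 2 (X 2) = Polynomial.C (X 1) := finSuccEquiv_X_succ (j := 1)
      rw [Ideal.map_span, Set.image_singleton]
      congr 2
      simp [finSuccEquiv_X_zero, e1, e2])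
  exact ⟨e.toMulEquiv.isDomain _, IsIntegrallyClosed.of_equiv e.symm⟩
end

section
/- The quotient ring S = ℂ[A,B,C,D]/I₀ is an integral domain. -/
open MvPolynomial

/-- Variables: `A = X 0`, `B = X 1`, `C = X 2`, `D = X 3`.
`I₀` is generated by the three 2×2 minors of `[[A², B, D], [C, A², B² − D]]`. -/
noncomputable def I₀ : Ideal (MvPolynomial (Fin 4) ℂ) :=
  Ideal.span
    { (X 0) ^ 4 - X 1 * X 2,
      (X 0) ^ 2 * ((X 1) ^ 2 - X 3) - X 2 * X 3,
      X 1 * ((X 1) ^ 2 - X 3) - (X 0) ^ 2 * X 3 }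

section aux

lemma aux_rel {K : Type*} [Field K] (a u : K) (hu : u ≠ 0) (hu1 : u + 1 ≠ 0) :
    a ^ 4 - a ^ 2 * u * (a ^ 2 / u) = 0 ∧
    a ^ 2 * ((a ^ 2 * u) ^ 2 - a ^ 4 * u ^ 3 / (u + 1)) - a ^ 2 / u * (a ^ 4 * u ^ 3 / (u + 1)) = 0 ∧
    a ^ 2 * u * ((a ^ 2 * u) ^ 2 - a ^ 4 * u ^ 3 / (u + 1)) - a ^ 2 * (a ^ 4 * u ^ 3 / (u + 1)) = 0
    := by
  refine ⟨?_, ?_, ?_⟩ <;> · field_simp; ring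

open Polynomial in
lemma aux_hom {R K : Type*} [CommRing R] [IsDomain R] [Field K] [Algebra R[X] K] [Algebra R K]
    [IsScalarTower R R[X] K] (T p q : R[X]) (hq : algebraMap R[X] K q ≠ 0) (n : ℕ)
    (hn : T.natDegree ≤ n) :
    ∃ H : R[X], algebraMap R[X] K q ^ n *
      Polynomial.aeval (algebraMap R[X] K p / algebraMap R[X] K q) T
      = algebraMap R[X] K (Polynomial.C (T.coeff n) * p ^ n + q * H) := by
  refine ⟨∑ i ∈ Finset.range n, Polynomial.C (T.coeff i) * p ^ i * q ^ (n - 1 - i), ?_⟩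
  have hC : ∀ r : R, algebraMap R K r = algebraMap R[X] K (Polynomial.C r) := fun r =>
    IsScalarTower.algebraMap_apply R R[X] K r
  rw [Polynomial.aeval_eq_sum_range' (Nat.lt_succ_of_le hn), Finset.sum_range_succ, mul_add,
    add_comm, map_add]
  congr 1
  · rw [Algebra.smul_def, hC, div_pow, map_mul, map_pow]
    field_simp
  · rw [Finset.mul_sum, Finset.mul_sum, map_sum]
    refine Finset.sum_congr rfl fun i hi => ?_
    have hi' := Finset.mem_range.mp hi
    obtain ⟨k, rfl⟩ : ∃ k, n = i + 1 + k := ⟨n - (i+1), by omega⟩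
    have : i + 1 + k - 1 - i = k := by omega
    rw [this, Algebra.smul_def, hC, div_pow]
    simp only [map_mul, map_pow]
    field_simp
    ring

open Polynomial in
lemma aux_indep {R K : Type*} [CommRing R] [IsDomain R] [Field K] [Algebra R[X] K] [Algebra R K]
    [IsScalarTower R R[X] K] (hinj : Function.Injective (algebraMap R[X] K))
    (a : R) (ha : a ≠ 0) (P Q T : R[X])
    (h : Polynomial.aeval (algebraMap R[X] K (Polynomial.C a ^ 2 * Polynomial.X)) P
      + Polynomial.aeval (algebraMap R[X] K (Polynomial.C a ^ 2) / algebraMap R[X] K Polynomial.X) Q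
      + Polynomial.aeval (algebraMap R[X] K (Polynomial.C a ^ 4 * Polynomial.X ^ 3) / algebraMap R[X] K (Polynomial.X + 1)) T = 0) :
    ∃ q t, Q = Polynomial.C q ∧ T = Polynomial.C t ∧ P + Polynomial.C q + Polynomial.C t = 0 := by
  have hX : algebraMap R[X] K Polynomial.X ≠ 0 := by
    rw [Ne, map_eq_zero_iff _ hinj]; exact Polynomial.X_ne_zero
  have hX1 : algebraMap R[X] K (Polynomial.X + 1) ≠ 0 := by
    rw [Ne, map_eq_zero_iff _ hinj]; exact (Polynomial.monic_X_add_C (1:R)).ne_zero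
  obtain ⟨H1, e1⟩ := aux_hom (K := K) Q (Polynomial.C a ^ 2) Polynomial.X hX _ le_rfl
  obtain ⟨H2, e2⟩ := aux_hom (K := K) T (Polynomial.C a ^ 4 * Polynomial.X ^ 3) (Polynomial.X + 1) hX1 _ le_rfl
  have e0 : Polynomial.aeval (algebraMap R[X] K (Polynomial.C a ^ 2 * Polynomial.X)) P
      = algebraMap R[X] K (Polynomial.aeval (Polynomial.C a ^ 2 * Polynomial.X) P) :=
    Polynomial.aeval_algebraMap_apply _ _ _
  set n := Q.natDegree
  set m := T.natDegree
  generalize Polynomial.aeval (Polynomial.C a ^ 2 * Polynomial.X) P = P' at e0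
  have key : Polynomial.X ^ n * (Polynomial.X + 1) ^ m * P'
      + (Polynomial.X + 1) ^ m * (Polynomial.C (Q.coeff n) * (Polynomial.C a ^ 2) ^ n + Polynomial.X * H1)
      + Polynomial.X ^ n * (Polynomial.C (T.coeff m) * (Polynomial.C a ^ 4 * Polynomial.X ^ 3) ^ m + (Polynomial.X + 1) * H2) = 0 := by
    apply hinj
    rw [map_add, map_add, map_mul, map_mul _ ((Polynomial.X + 1) ^ m) (_ + _), ← e1,
      map_mul _ (Polynomial.X ^ n) (_ + _), ← e2, ← e0, map_zero]
    simp only [map_mul, map_pow] at h ⊢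
    linear_combination (algebraMap R[X] K Polynomial.X ^ n *
      algebraMap R[X] K (Polynomial.X + 1) ^ m) * h
  have hm : m = 0 := by
    by_contra hm
    have := congrArg (Polynomial.eval (-1)) key
    simp [hm, ha] at this
    have hT : T = 0 := Polynomial.leadingCoeff_eq_zero.mp this
    exact hm (by simp [m, hT])
  have hn : n = 0 := by
    by_contra hn
    have := congrArg (Polynomial.eval 0) key
    simp [hn, ha] at this
    have hQ : Q = 0 := Polynomial.leadingCoeff_eq_zero.mp this
    exact hn (by simp [n, hQ])
  obtain ⟨q, hq⟩ := Polynomial.natDegree_eq_zero.mp hn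
  obtain ⟨t, ht⟩ := Polynomial.natDegree_eq_zero.mp hm
  refine ⟨q, t, hq.symm, ht.symm, ?_⟩
  have h2 : Polynomial.aeval (algebraMap R[X] K (Polynomial.C a ^ 2 * Polynomial.X)) (P + Polynomial.C q + Polynomial.C t) = 0 := by
    rw [← h, ← hq, ← ht]; simp
  rw [Polynomial.aeval_algebraMap_apply, map_eq_zero_iff _ hinj] at h2
  have h3 : (P + Polynomial.C q + Polynomial.C t).comp (Polynomial.C (a ^ 2) * Polynomial.X) = 0 := by
    rw [← h2, Polynomial.comp, Polynomial.aeval_def, Polynomial.algebraMap_eq, Polynomial.C_pow]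
  rcases Polynomial.comp_eq_zero_iff.mp h3 with h4 | ⟨_, h4⟩
  · exact h4
  · have := congrArg (fun p => Polynomial.coeff p 1) h4
    simp [ha, ← Polynomial.C_pow, -map_pow] at this

/-- the spanning module -/
noncomputable def auxN (R : Type*) {S : Type*} [CommRing R] [CommRing S] [Algebra R S]
    (b c d : S) : Submodule R S :=
  LinearMap.range (Polynomial.aeval (R := R) b).toLinearMap ⊔
  LinearMap.range (Polynomial.aeval (R := R) c).toLinearMap ⊔
  LinearMap.range (Polynomial.aeval (R := R) d).toLinearMap

variable {R S : Type*} [CommRing R] [CommRing S] [Algebra R S] (a : R) (b c d : S)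

lemma auxN_b (j : ℕ) : b ^ j ∈ auxN R b c d :=
  Submodule.mem_sup_left (Submodule.mem_sup_left ⟨Polynomial.X ^ j, by simp⟩)
lemma auxN_c (j : ℕ) : c ^ j ∈ auxN R b c d :=
  Submodule.mem_sup_left (Submodule.mem_sup_right ⟨Polynomial.X ^ j, by simp⟩)
lemma auxN_d (j : ℕ) : d ^ j ∈ auxN R b c d :=
  Submodule.mem_sup_right ⟨Polynomial.X ^ j, by simp⟩

lemma auxN_mul (y : S) (hb : ∀ j, y * b ^ j ∈ auxN R b c d) (hc : ∀ j, y * c ^ j ∈ auxN R b c d)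
    (hd : ∀ j, y * d ^ j ∈ auxN R b c d) (x : S) (hx : x ∈ auxN R b c d) :
    y * x ∈ auxN R b c d := by
  have gen : ∀ z : S, (∀ j, y * z ^ j ∈ auxN R b c d) → ∀ p : Polynomial R,
      y * Polynomial.aeval z p ∈ auxN R b c d := by
    intro z hz p
    rw [Polynomial.aeval_eq_sum_range, Finset.mul_sum]
    refine Submodule.sum_mem _ fun i _ => ?_
    rw [mul_smul_comm]
    exact Submodule.smul_mem _ _ (hz i)
  obtain ⟨x1, h1, _, ⟨r, rfl⟩, rfl⟩ := Submodule.mem_sup.mp hx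
  obtain ⟨_, ⟨p, rfl⟩, _, ⟨q, rfl⟩, rfl⟩ := Submodule.mem_sup.mp h1
  rw [mul_add, mul_add]
  exact add_mem (add_mem (gen b hb p) (gen c hc q)) (gen d hd r)

lemma auxN_bd (h3 : b * (b ^ 2 - d) = a ^ 2 • d) (l j : ℕ) :
    b ^ j * d ^ l ∈ auxN R b c d := by
  induction l generalizing j with
  | zero => simpa using auxN_b b c d j
  | succ l ih =>
    induction j with
    | zero => simpa using auxN_d b c d (l+1)
    | succ j ihj =>
      have : b ^ (j+1) * d ^ (l+1) = b ^ (j+3) * d ^ l - a ^ 2 • (b ^ j * d ^ (l+1)) := by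
        rw [Algebra.smul_def] at *
        linear_combination (-b ^ j * d ^ l) * h3
      rw [this]
      exact sub_mem (ih _) (Submodule.smul_mem _ _ ihj)

lemma auxN_mul_b (h1 : a ^ 4 • (1 : S) = b * c) (h3 : b * (b ^ 2 - d) = a ^ 2 • d) (x : S)
    (hx : x ∈ auxN R b c d) : b * x ∈ auxN R b c d := by
  refine auxN_mul b c d b (fun j => ?_) (fun j => ?_) (fun j => ?_) x hx
  · rw [← pow_succ']; exact auxN_b b c d _
  · cases j with
    | zero => simpa using auxN_b (R := R) b c d 1
    | succ j =>
      rw [pow_succ', ← mul_assoc, ← h1, smul_mul_assoc, one_mul]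
      exact Submodule.smul_mem _ _ (auxN_c b c d _)
  · simpa using auxN_bd a b c d h3 j 1

lemma auxN_mul_c (h1 : a ^ 4 • (1 : S) = b * c) (h2 : a ^ 2 • (b ^ 2 - d) = c * d)
    (h3 : b * (b ^ 2 - d) = a ^ 2 • d) (x : S)
    (hx : x ∈ auxN R b c d) : c * x ∈ auxN R b c d := by
  refine auxN_mul b c d c (fun j => ?_) (fun j => ?_) (fun j => ?_) x hx
  · cases j with
    | zero => simpa using auxN_c (R := R) b c d 1
    | succ j =>
      rw [pow_succ', ← mul_assoc, mul_comm c b, ← h1, smul_mul_assoc, one_mul]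
      exact Submodule.smul_mem _ _ (auxN_b b c d _)
  · rw [← pow_succ']; exact auxN_c b c d _
  · cases j with
    | zero => simpa using auxN_c (R := R) b c d 1
    | succ j =>
      rw [pow_succ', ← mul_assoc, ← h2, smul_mul_assoc, sub_mul, ← pow_succ']
      exact Submodule.smul_mem _ _ (sub_mem (auxN_bd a b c d h3 _ _) (auxN_d b c d _))

lemma auxN_mul_d (h2 : a ^ 2 • (b ^ 2 - d) = c * d)
    (h1 : a ^ 4 • (1 : S) = b * c) (h3 : b * (b ^ 2 - d) = a ^ 2 • d) (x : S)
    (hx : x ∈ auxN R b c d) : d * x ∈ auxN R b c d := by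
  refine auxN_mul b c d d (fun j => ?_) (fun j => ?_) (fun j => ?_) x hx
  · rw [mul_comm]; simpa using auxN_bd a b c d h3 1 j
  · induction j with
    | zero => simpa using auxN_d (R := R) b c d 1
    | succ j ih =>
      have : d * c ^ (j + 1) = c * (d * c ^ j) := by ring
      rw [this]
      exact auxN_mul_c a b c d h1 h2 h3 _ ih
  · rw [← pow_succ']; exact auxN_d b c d _

open Polynomial in
lemma aux_inj {K : Type*} [IsDomain R] [Field K] [Algebra R[X] K] [Algebra R K]
    [IsScalarTower R R[X] K] (hinj : Function.Injective (algebraMap R[X] K)) (ha : a ≠ 0)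
    (htop : ∀ x, x ∈ auxN R b c d) (φ : S →ₐ[R] K)
    (hb : φ b = algebraMap R[X] K (Polynomial.C a ^ 2 * Polynomial.X))
    (hc : φ c = algebraMap R[X] K (Polynomial.C a ^ 2) / algebraMap R[X] K Polynomial.X)
    (hd : φ d = algebraMap R[X] K (Polynomial.C a ^ 4 * Polynomial.X ^ 3) / algebraMap R[X] K (Polynomial.X + 1)) :
    Function.Injective φ := by
  rw [injective_iff_map_eq_zero]
  intro x hx
  obtain ⟨x1, h1, _, ⟨r, rfl⟩, rfl⟩ := Submodule.mem_sup.mp (htop x)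
  obtain ⟨_, ⟨p, rfl⟩, _, ⟨q, rfl⟩, rfl⟩ := Submodule.mem_sup.mp h1
  simp only [AlgHom.toLinearMap_apply, map_add] at hx ⊢
  rw [← Polynomial.aeval_algHom_apply, ← Polynomial.aeval_algHom_apply,
    ← Polynomial.aeval_algHom_apply, hb, hc, hd] at hx
  obtain ⟨s, t, rfl, rfl, h⟩ := aux_indep hinj a ha _ _ _ hx
  have := congrArg (Polynomial.aeval b) h
  simpa using this

end aux

/-- The quotient ring `S = ℂ[A,B,C,D]/I₀` is an integral domain. -/
theorem stmt_7 : IsDomain (MvPolynomial (Fin 4) ℂ ⧸ I₀) := by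
  let mk := Ideal.Quotient.mk I₀
  let ρ : Polynomial ℂ →+* (MvPolynomial (Fin 4) ℂ ⧸ I₀) :=
    mk.comp (Polynomial.aeval (R := ℂ) (X 0 : MvPolynomial (Fin 4) ℂ)).toRingHom
  letI : Algebra (Polynomial ℂ) (MvPolynomial (Fin 4) ℂ ⧸ I₀) := ρ.toAlgebra
  have hsm : ∀ (r : Polynomial ℂ) (s : MvPolynomial (Fin 4) ℂ ⧸ I₀), r • s = ρ r * s :=
    fun r s => rfl
  have hρX : ρ Polynomial.X = mk (X 0) := by simp [ρ]
  have hρC : ∀ z, ρ (Polynomial.C z) = mk (C z) := by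
    intro z; simp [ρ, MvPolynomial.algebraMap_eq]
  have g1 : (X 0) ^ 4 - X 1 * X 2 ∈ I₀ := Ideal.subset_span (by simp)
  have g2 : (X 0) ^ 2 * ((X 1) ^ 2 - X 3) - X 2 * X 3 ∈ I₀ := Ideal.subset_span (by simp)
  have g3 : X 1 * ((X 1) ^ 2 - X 3) - (X 0) ^ 2 * X 3 ∈ I₀ := Ideal.subset_span (by simp)
  have h1 : (Polynomial.X : Polynomial ℂ) ^ 4 • (1 : MvPolynomial (Fin 4) ℂ ⧸ I₀)
      = mk (X 1) * mk (X 2) := by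
    rw [hsm, mul_one, map_pow, hρX, ← map_pow, ← map_mul]; exact Ideal.Quotient.eq.mpr g1
  have h2 : (Polynomial.X : Polynomial ℂ) ^ 2 • (mk (X 1) ^ 2 - mk (X 3))
      = mk (X 2) * mk (X 3) := by
    rw [hsm, map_pow, hρX]
    simp only [← map_pow, ← map_mul, ← map_sub]; exact Ideal.Quotient.eq.mpr g2
  have h3 : mk (X 1) * (mk (X 1) ^ 2 - mk (X 3)) =
      (Polynomial.X : Polynomial ℂ) ^ 2 • mk (X 3) := by
    rw [hsm, map_pow, hρX]
    simp only [← map_pow, ← map_mul, ← map_sub]; exact Ideal.Quotient.eq.mpr g3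
  have htop : ∀ x, x ∈ auxN (Polynomial ℂ) (mk (X 1)) (mk (X 2)) (mk (X 3)) := by
    intro x
    obtain ⟨f, rfl⟩ := Ideal.Quotient.mk_surjective x
    induction f using MvPolynomial.induction_on with
    | C z =>
      have : mk (C z) = (Polynomial.C z) • (mk (X 1)) ^ 0 := by rw [hsm, hρC]; simp
      change mk (C z) ∈ _
      rw [this]
      exact Submodule.smul_mem _ _ (auxN_b _ _ _ 0)
    | add p q hp hq => rw [map_add]; exact add_mem hp hq
    | mul_X p i hp =>
      rw [mul_comm, map_mul]
      change mk (X i) * mk p ∈ _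
      change mk p ∈ _ at hp
      fin_cases i
      · change mk (X 0) * mk p ∈ _
        rw [← hρX, ← hsm]
        exact Submodule.smul_mem _ _ hp
      · exact auxN_mul_b _ _ _ _ h1 h3 _ hp
      · exact auxN_mul_c _ _ _ _ h1 h2 h3 _ hp
      · exact auxN_mul_d _ _ _ _ h2 h1 h3 _ hp
  let K := FractionRing (Polynomial (Polynomial ℂ))
  let ι := algebraMap (Polynomial (Polynomial ℂ)) K
  have hinj : Function.Injective ι := IsFractionRing.injective _ _
  let a : Polynomial (Polynomial ℂ) := Polynomial.C Polynomial.X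
  have hX : ι Polynomial.X ≠ 0 := by
    rw [Ne, map_eq_zero_iff _ hinj]; exact Polynomial.X_ne_zero
  have hX1 : ι (Polynomial.X + 1) ≠ 0 := by
    rw [Ne, map_eq_zero_iff _ hinj]; exact (Polynomial.monic_X_add_C (1:Polynomial ℂ)).ne_zero
  let v : Fin 4 → K := ![ι a, ι (a ^ 2 * Polynomial.X), ι (a ^ 2) / ι Polynomial.X,
    ι (a ^ 4 * Polynomial.X ^ 3) / ι (Polynomial.X + 1)]
  let ψ : MvPolynomial (Fin 4) ℂ →+* K :=
    eval₂Hom (ι.comp (Polynomial.C.comp Polynomial.C)) v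
  have p0 : ψ (X 0) = ι a := by simp [ψ, v]
  have p1 : ψ (X 1) = ι (a ^ 2 * Polynomial.X) := by simp [ψ, v]
  have p2 : ψ (X 2) = ι (a ^ 2) / ι Polynomial.X := by simp [ψ, v]
  have p3 : ψ (X 3) = ι (a ^ 4 * Polynomial.X ^ 3) / ι (Polynomial.X + 1) := by simp [ψ, v]
  have hle : ∀ f ∈ I₀, ψ f = 0 := by
    intro f hf
    have : I₀ ≤ RingHom.ker ψ := by
      refine Ideal.span_le.mpr ?_
      have hX1' : ι Polynomial.X + 1 ≠ 0 := by simpa using hX1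
      obtain ⟨k1, k2, k3⟩ := aux_rel (ι a) (ι Polynomial.X) hX hX1'
      rintro g (rfl | rfl | rfl) <;>
        simp only [SetLike.mem_coe, RingHom.mem_ker, map_sub, map_mul, map_pow, p0, p1, p2, p3,
          map_add, map_one]
      · exact k1
      · exact k2
      · exact k3
    exact this hf
  let φ₀ : (MvPolynomial (Fin 4) ℂ ⧸ I₀) →+* K := Ideal.Quotient.lift I₀ ψ hle
  have hφ : ∀ f, φ₀ (mk f) = ψ f := fun f => Ideal.Quotient.lift_mk _ _ _
  have hcomp : φ₀.comp ρ = ι.comp Polynomial.C := by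
    refine Polynomial.ringHom_ext (fun z => ?_) ?_
    · rw [RingHom.comp_apply, hρC, hφ]; simp [ψ]
    · rw [RingHom.comp_apply, hρX, hφ, p0]; rfl
  let φ : (MvPolynomial (Fin 4) ℂ ⧸ I₀) →ₐ[Polynomial ℂ] K :=
    { φ₀ with
      commutes' := fun r => by
        have := congrArg (fun g => g r) hcomp
        exact this.trans (IsScalarTower.algebraMap_apply (Polynomial ℂ) (Polynomial (Polynomial ℂ)) K r).symm }
  have hφinj : Function.Injective φ :=
    aux_inj (Polynomial.X : Polynomial ℂ) (mk (X 1)) (mk (X 2)) (mk (X 3)) hinj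
      Polynomial.X_ne_zero htop φ ((hφ _).trans p1) ((hφ _).trans p2) ((hφ _).trans p3)
  exact Function.Injective.isDomain φ.toRingHom hφinj
end

section
/- The ring R = ℂ[A,B,C,D,T]/I_T, viewed as a module over ℂ[T] via the natural map T ↦ class of T, is flat. -/
open MvPolynomial

/-- Variables: `A = X 0`, `B = X 1`, `C = X 2`, `D = X 3`, `T = X 4`. -/
noncomputable def m₁ : MvPolynomial (Fin 5) ℂ :=
  ((X 0) ^ 2 + (X 4) ^ 5) * (X 0) ^ 2 - X 1 * X 2

noncomputable def m₂ : MvPolynomial (Fin 5) ℂ :=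
  ((X 0) ^ 2 + (X 4) ^ 5) * ((X 1) ^ 2 - X 3) - X 2 * X 3

noncomputable def m₃ : MvPolynomial (Fin 5) ℂ :=
  X 1 * ((X 1) ^ 2 - X 3) - (X 0) ^ 2 * X 3

/-- The ideal generated by the three 2×2 minors of
`[[A² + T⁵, B, D], [C, A², B² − D]]`. -/
noncomputable def I_T : Ideal (MvPolynomial (Fin 5) ℂ) :=
  Ideal.span {m₁, m₂, m₃}

/-- The `ℂ[T]`-algebra structure on `R = ℂ[A,B,C,D,T]/I_T` given by the
natural map `T ↦` class of `T`. -/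
noncomputable instance : Algebra (Polynomial ℂ) (MvPolynomial (Fin 5) ℂ ⧸ I_T) :=
  (Polynomial.aeval (Ideal.Quotient.mk I_T (X 4)) :
    Polynomial ℂ →ₐ[ℂ] MvPolynomial (Fin 5) ℂ ⧸ I_T).toRingHom.toAlgebra

namespace FlatAux

/-- the normal-form monomials -/
def mon {R : Type*} [CommRing R] (B C D : R) : ℕ ⊕ ℕ → R
  | Sum.inl n => D ^ (n / 3) * B ^ (n % 3)
  | Sum.inr k => C ^ (k + 1)

/-- the order of a normal-form monomial -/
def deg : ℕ ⊕ ℕ → ℤ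
  | Sum.inl n => n
  | Sum.inr k => -((k : ℤ) + 1)

lemma deg_inj : Function.Injective deg := by
  rintro (a | a) (b | b) h <;> simp only [deg] at h
  · congr 1; omega
  · omega
  · omega
  · congr 1; omega

section span
variable {P R : Type*} [CommRing P] [CommRing R] [Algebra P R] (a q : P) (B C D : R)

lemma span_top
    (h1 : B * C = (q * a) • (1 : R)) (h2 : C * D = q • (B ^ 2 - D))
    (h3 : B ^ 3 = B * D + a • D) (htop : Algebra.adjoin P {B, C, D} = ⊤) :
    Submodule.span P (Set.range (mon B C D)) = ⊤ := by
  set N := Submodule.span P (Set.range (mon B C D)) with hN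
  have hl : ∀ j l : ℕ, l < 3 → D ^ j * B ^ l ∈ N := by
    intro j l hl
    refine Submodule.subset_span ⟨Sum.inl (3 * j + l), ?_⟩
    have e1 : (3 * j + l) / 3 = j := by omega
    have e2 : (3 * j + l) % 3 = l := by omega
    simp only [mon, e1, e2]
  have hr : ∀ k : ℕ, C ^ k ∈ N := by
    intro k
    cases k with
    | zero => simpa using hl 0 0 (by norm_num)
    | succ k => exact Submodule.subset_span ⟨Sum.inr k, rfl⟩
  have hB : ∀ x ∈ N, B * x ∈ N := by
    intro x hx
    induction hx using Submodule.span_induction with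
    | zero => simp
    | add x y _ _ hx hy => rw [mul_add]; exact N.add_mem hx hy
    | smul p x _ hx => rw [mul_smul_comm]; exact N.smul_mem _ hx
    | mem x hx =>
      obtain ⟨n | k, rfl⟩ := hx
      · simp only [mon]
        have hlt : n % 3 < 3 := Nat.mod_lt _ (by norm_num)
        generalize n / 3 = j
        generalize n % 3 = l at hlt
        by_cases h : l = 2
        · subst h
          have : B * (D ^ j * B ^ 2) = D ^ (j + 1) * B ^ 1 + a • (D ^ (j + 1) * B ^ 0) := by
            have : B * (D ^ j * B ^ 2) = D ^ j * B ^ 3 := by ring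
            rw [this, h3, mul_add, mul_smul_comm]
            congr 1
            · ring
            · congr 1; ring
          rw [this]
          exact N.add_mem (hl _ _ (by norm_num)) (N.smul_mem _ (hl _ _ (by norm_num)))
        · have : B * (D ^ j * B ^ l) = D ^ j * B ^ (l + 1) := by ring
          rw [this]; exact hl _ _ (by omega)
      · have : B * C ^ (k + 1) = (q * a) • C ^ k := by
          rw [pow_succ', ← mul_assoc, h1, smul_mul_assoc, one_mul]
        simp only [mon]
        rw [this]; exact N.smul_mem _ (hr k)
  have hDC : ∀ k : ℕ, D * C ^ k ∈ N := by
    intro k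
    induction k with
    | zero => simpa using hl 1 0 (by norm_num)
    | succ k ih =>
      have : D * C ^ (k + 1) = q • (B * (B * C ^ k) - D * C ^ k) := by
        have : D * C ^ (k + 1) = (C * D) * C ^ k := by ring
        rw [this, h2, smul_mul_assoc]
        congr 1; ring
      rw [this]
      exact N.smul_mem _ (N.sub_mem (hB _ (hB _ (hr k))) ih)
  have hD : ∀ x ∈ N, D * x ∈ N := by
    intro x hx
    induction hx using Submodule.span_induction with
    | zero => simp
    | add x y _ _ hx hy => rw [mul_add]; exact N.add_mem hx hy
    | smul p x _ hx => rw [mul_smul_comm]; exact N.smul_mem _ hx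
    | mem x hx =>
      obtain ⟨n | k, rfl⟩ := hx
      · simp only [mon]
        rw [← mul_assoc, ← pow_succ']
        exact hl _ _ (Nat.mod_lt _ (by norm_num))
      · exact hDC _
  have hC : ∀ x ∈ N, C * x ∈ N := by
    intro x hx
    induction hx using Submodule.span_induction with
    | zero => simp
    | add x y _ _ hx hy => rw [mul_add]; exact N.add_mem hx hy
    | smul p x _ hx => rw [mul_smul_comm]; exact N.smul_mem _ hx
    | mem x hx =>
      obtain ⟨n | k, rfl⟩ := hx
      · simp only [mon]
        have hlt : n % 3 < 3 := Nat.mod_lt _ (by norm_num)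
        generalize n / 3 = j
        generalize n % 3 = l at hlt
        cases l with
        | succ l =>
          have : C * (D ^ j * B ^ (l + 1)) = (q * a) • (D ^ j * B ^ l) := by
            have : C * (D ^ j * B ^ (l + 1)) = (B * C) * (D ^ j * B ^ l) := by ring
            rw [this, h1, smul_mul_assoc, one_mul]
          rw [this]; exact N.smul_mem _ (hl _ _ (by omega))
        | zero =>
          cases j with
          | zero => simpa using hr 1
          | succ j =>
            have : C * (D ^ (j + 1) * B ^ 0) = q • (D ^ j * B ^ 2 - D ^ (j + 1) * B ^ 0) := by
              have : C * (D ^ (j + 1) * B ^ 0) = (C * D) * D ^ j := by ring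
              rw [this, h2, smul_mul_assoc]
              congr 1; ring
            rw [this]
            exact N.smul_mem _ (N.sub_mem (hl _ _ (by norm_num)) (hl _ _ (by norm_num)))
      · simp only [mon]
        rw [← pow_succ']; exact hr _
  rw [eq_top_iff]
  rintro x -
  have key : ∀ y ∈ Algebra.adjoin P {B, C, D}, ∀ x ∈ N, y * x ∈ N := by
    intro y hy
    induction hy using Algebra.adjoin_induction with
    | mem y hy =>
      rcases hy with rfl | rfl | rfl
      · exact hB
      · exact hC
      · exact hD
    | algebraMap r => intro x hx; rw [← Algebra.smul_def]; exact N.smul_mem _ hx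
    | add y z _ _ hy hz => intro x hx; rw [add_mul]; exact N.add_mem (hy x hx) (hz x hx)
    | mul y z _ _ hy hz => intro x hx; rw [mul_assoc]; exact hy _ (hz x hx)
  have := key x (htop ▸ Algebra.mem_top) 1 (by simpa using hr 0)
  simpa using this

end span

lemma indep {P ι : Type*} [CommRing P] [IsDomain P] (d : ι → ℤ) (hd : Function.Injective d)
    (e : ι → LaurentSeries P) (w : ι → PowerSeries P)
    (he : ∀ i, e i = HahnSeries.single (d i) (1 : P) * HahnSeries.ofPowerSeries ℤ P (w i))
    (hw : ∀ i, PowerSeries.constantCoeff (w i) ≠ 0) (c : ι →₀ P)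
    (hc : c.sum (fun i p => HahnSeries.C p * e i) = 0) : c = 0 := by
  by_contra hne
  obtain ⟨i, hi, hmin⟩ := Finset.exists_min_image c.support d (Finsupp.support_nonempty_iff.2 hne)
  have h := congrArg (fun x : LaurentSeries P => x.coeff (d i)) hc
  simp only [Finsupp.sum, HahnSeries.coeff_sum, HahnSeries.coeff_zero] at h
  rw [Finset.sum_eq_single i] at h
  · rw [HahnSeries.C_mul_eq_smul, HahnSeries.coeff_smul, he, HahnSeries.coeff_single_mul,
      PowerSeries.coeff_coe] at h
    simp at h
    rcases h with h | h
    · exact (Finsupp.mem_support_iff.1 hi) h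
    · exact hw i h
  · intro j hj hji
    have : d i < d j := lt_of_le_of_ne (hmin j hj) (fun h => hji (hd h.symm))
    rw [HahnSeries.C_mul_eq_smul, HahnSeries.coeff_smul, he, HahnSeries.coeff_single_mul,
      PowerSeries.coeff_coe, if_pos (by omega)]
    simp
  · intro h; exact absurd hi h

/-- the coefficient ring, `T` inside and `A` outside -/
abbrev P := Polynomial (Polynomial ℂ)

noncomputable abbrev pA : P := Polynomial.X
noncomputable abbrev pT : P := Polynomial.C Polynomial.X
noncomputable abbrev pq : P := pA ^ 2 + pT ^ 5

lemma pq_ne : pq ≠ 0 := by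
  have : (pq).coeff 2 = 1 := by
    simp only [pq, pA, pT, ← map_pow, Polynomial.coeff_add, Polynomial.coeff_X_pow,
      Polynomial.coeff_C]
    simp
  intro h
  rw [h] at this
  simp at this

noncomputable def u : PowerSeries P := PowerSeries.invOfUnit (1 + PowerSeries.X) 1

lemma u_mul : (1 + PowerSeries.X) * u = 1 :=
  PowerSeries.mul_invOfUnit _ _ (by simp)

lemma u_const : PowerSeries.constantCoeff u = 1 := by
  have := congrArg PowerSeries.constantCoeff u_mul
  simpa using this

noncomputable def mu (n : ℤ) : LaurentSeries P := HahnSeries.single n 1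

lemma mu_add (m n : ℤ) : mu m * mu n = mu (m + n) := by simp [mu]
lemma mu_zero : mu 0 = 1 := rfl
lemma mu_pow (m : ℤ) (k : ℕ) : mu m ^ k = mu (k * m) := by simp [mu]

noncomputable def cc : P →+* LaurentSeries P := HahnSeries.C
noncomputable def U : LaurentSeries P := HahnSeries.ofPowerSeries ℤ P u

lemma U_mul : (1 + mu 1) * U = 1 := by
  have := congrArg (HahnSeries.ofPowerSeries ℤ P) u_mul
  simpa [U, mu, HahnSeries.ofPowerSeries_X] using this

noncomputable def lB : LaurentSeries P := cc pA ^ 2 * mu 1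
noncomputable def lC : LaurentSeries P := cc pq * mu (-1)
noncomputable def lD : LaurentSeries P := cc pA ^ 4 * mu 1 ^ 3 * U

noncomputable def phi0 : MvPolynomial (Fin 5) ℂ →+* LaurentSeries P :=
  MvPolynomial.eval₂Hom (cc.comp (Polynomial.C.comp Polynomial.C))
    ![cc pA, lB, lC, lD, cc pT]

lemma id1 {K : Type*} [CommRing K] (a t m n : K) (hm : m * n = 1) :
    (a ^ 2 + t ^ 5) * a ^ 2 - a ^ 2 * m * ((a ^ 2 + t ^ 5) * n) = 0 := by
  linear_combination (-(a ^ 2 + t ^ 5) * a ^ 2) * hm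

lemma id2 {K : Type*} [CommRing K] (a t m n v : K) (hm : m * n = 1) (hv : (1 + m) * v = 1) :
    (a ^ 2 + t ^ 5) * ((a ^ 2 * m) ^ 2 - a ^ 4 * m ^ 3 * v)
      - (a ^ 2 + t ^ 5) * n * (a ^ 4 * m ^ 3 * v) = 0 := by
  linear_combination (-(a ^ 2 + t ^ 5) * a ^ 4 * m ^ 2 * v) * hm
        - ((a ^ 2 + t ^ 5) * a ^ 4 * m ^ 2) * hv

lemma id3 {K : Type*} [CommRing K] (a m v : K) (hv : (1 + m) * v = 1) :
    a ^ 2 * m * ((a ^ 2 * m) ^ 2 - a ^ 4 * m ^ 3 * v) - a ^ 2 * (a ^ 4 * m ^ 3 * v) = 0 := by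
  linear_combination (-a ^ 6 * m ^ 3) * hv

lemma phi0_ker : ∀ x ∈ I_T, phi0 x = 0 := by
  have hm : mu 1 * mu (-1) = 1 := by rw [mu_add]; exact mu_zero
  have hU := U_mul
  have e0 : phi0 (X 0) = cc pA := by simp [phi0]
  have e1 : phi0 (X 1) = lB := by simp [phi0]
  have e2 : phi0 (X 2) = lC := by simp [phi0]
  have e3 : phi0 (X 3) = lD := by simp [phi0]
  have e4 : phi0 (X 4) = cc pT := by simp [phi0]
  have hq : cc pq = cc pA ^ 2 + cc pT ^ 5 := by simp [pq]
  have : I_T ≤ RingHom.ker phi0 := by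
    rw [I_T, Ideal.span_le]
    rintro x (rfl | rfl | rfl)
    · change phi0 m₁ = 0
      rw [m₁, map_sub]
      simp only [map_mul, map_add, map_pow, e0, e1, e2, e4, lB, lC, hq]
      exact id1 (cc pA) (cc pT) (mu 1) (mu (-1)) hm
    · change phi0 m₂ = 0
      rw [m₂, map_sub, map_mul, map_sub]
      simp only [map_mul, map_add, map_pow, e0, e1, e2, e3, e4, lB, lC, lD, hq]
      exact id2 (cc pA) (cc pT) (mu 1) (mu (-1)) U hm hU
    · change phi0 m₃ = 0
      rw [m₃, map_sub, map_mul, map_sub]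
      simp only [map_mul, map_add, map_pow, e0, e1, e3, lB, lD]
      exact id3 (cc pA) (mu 1) U hU
  exact fun x hx => this hx

noncomputable def phi : MvPolynomial (Fin 5) ℂ ⧸ I_T →+* LaurentSeries P :=
  Ideal.Quotient.lift I_T phi0 phi0_ker

noncomputable def psi : P →+* MvPolynomial (Fin 5) ℂ ⧸ I_T :=
  Polynomial.eval₂RingHom (Polynomial.eval₂RingHom
    ((Ideal.Quotient.mk I_T).comp MvPolynomial.C) (Ideal.Quotient.mk I_T (X 4)))
    (Ideal.Quotient.mk I_T (X 0))

lemma phi_psi (p : P) : phi (psi p) = cc p := by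
  have : phi.comp psi = cc := by
    ext <;> simp [phi, psi, phi0]
  exact congrArg (fun f => f p) this

noncomputable def rr (i : Fin 5) : MvPolynomial (Fin 5) ℂ ⧸ I_T := Ideal.Quotient.mk I_T (X i)

lemma span_R (x : MvPolynomial (Fin 5) ℂ ⧸ I_T) :
    ∃ c : ℕ ⊕ ℕ →₀ P, c.sum (fun i p => psi p * mon (rr 1) (rr 2) (rr 3) i) = x := by
  let _ : Algebra P (MvPolynomial (Fin 5) ℂ ⧸ I_T) := psi.toAlgebra
  have hs : ∀ (p : P) (x : MvPolynomial (Fin 5) ℂ ⧸ I_T), p • x = psi p * x := fun _ _ => rfl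
  have psiA : psi pA = rr 0 := by simp [psi, rr]
  have psiT : psi pT = rr 4 := by simp [psi, rr]
  have psiq : psi pq = rr 0 ^ 2 + rr 4 ^ 5 := by
    simp only [pq, map_add, map_pow, psiA, psiT]
  have q1 : (rr 0 ^ 2 + rr 4 ^ 5) * rr 0 ^ 2 - rr 1 * rr 2 = 0 := by
    have : Ideal.Quotient.mk I_T m₁ = 0 :=
      Ideal.Quotient.eq_zero_iff_mem.2 (Ideal.subset_span (by simp))
    simpa only [m₁, map_sub, map_mul, map_add, map_pow, rr] using this
  have q2 : (rr 0 ^ 2 + rr 4 ^ 5) * (rr 1 ^ 2 - rr 3) - rr 2 * rr 3 = 0 := by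
    have : Ideal.Quotient.mk I_T m₂ = 0 :=
      Ideal.Quotient.eq_zero_iff_mem.2 (Ideal.subset_span (by simp))
    simpa only [m₂, map_sub, map_mul, map_add, map_pow, rr] using this
  have q3 : rr 1 * (rr 1 ^ 2 - rr 3) - rr 0 ^ 2 * rr 3 = 0 := by
    have : Ideal.Quotient.mk I_T m₃ = 0 :=
      Ideal.Quotient.eq_zero_iff_mem.2 (Ideal.subset_span (by simp))
    simpa only [m₃, map_sub, map_mul, map_add, map_pow, rr] using this
  have htop : Algebra.adjoin P {rr 1, rr 2, rr 3} = ⊤ := by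
    rw [eq_top_iff]
    rintro y -
    obtain ⟨y, rfl⟩ := Ideal.Quotient.mk_surjective y
    induction y using MvPolynomial.induction_on with
    | C z =>
      have : Ideal.Quotient.mk I_T (MvPolynomial.C z)
          = algebraMap P _ (Polynomial.C (Polynomial.C z)) := by
        change _ = psi _
        simp [psi]
      rw [this]; exact Subalgebra.algebraMap_mem _ _
    | add y z hy hz => rw [map_add]; exact add_mem hy hz
    | mul_X y i hy =>
      rw [map_mul]
      refine mul_mem hy ?_
      change rr i ∈ _
      fin_cases i
      · change rr 0 ∈ _
        rw [← psiA]; exact Subalgebra.algebraMap_mem _ pA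
      · exact Algebra.subset_adjoin (by simp)
      · exact Algebra.subset_adjoin (by simp)
      · exact Algebra.subset_adjoin (by simp)
      · change rr 4 ∈ _
        rw [← psiT]; exact Subalgebra.algebraMap_mem _ pT
  have h := span_top (pA ^ 2) pq (rr 1) (rr 2) (rr 3)
    (by rw [hs, map_mul, psiq, map_pow, psiA]; linear_combination -q1)
    (by rw [hs, psiq]; linear_combination -q2)
    (by rw [hs, map_pow, psiA]; linear_combination q3) htop
  have hx : x ∈ Submodule.span P (Set.range (mon (rr 1) (rr 2) (rr 3))) := by
    rw [h]; exact Submodule.mem_top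
  exact (Finsupp.mem_span_range_iff_exists_finsupp).1 hx

lemma phi_rr1 : phi (rr 1) = lB := by simp [phi, rr, phi0]
lemma phi_rr2 : phi (rr 2) = lC := by simp [phi, rr, phi0]
lemma phi_rr3 : phi (rr 3) = lD := by simp [phi, rr, phi0]

noncomputable def ww : ℕ ⊕ ℕ → PowerSeries P
  | Sum.inl n => PowerSeries.C (pA ^ (4 * (n / 3) + 2 * (n % 3))) * u ^ (n / 3)
  | Sum.inr k => PowerSeries.C (pq ^ (k + 1))

lemma ww_ne (i : ℕ ⊕ ℕ) : PowerSeries.constantCoeff (ww i) ≠ 0 := by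
  rcases i with n | k
  · simp [ww, u_const, pA]
  · simp only [ww, PowerSeries.constantCoeff_C]
    exact pow_ne_zero _ pq_ne

lemma mon_eq (i : ℕ ⊕ ℕ) : mon lB lC lD i =
    HahnSeries.single (deg i) (1 : P) * HahnSeries.ofPowerSeries ℤ P (ww i) := by
  rcases i with n | k
  · have h : ((n : ℕ) : ℤ) = (3 * (n / 3) + n % 3 : ℕ) := by
      congr 1; omega
    have : HahnSeries.single (deg (Sum.inl n)) (1 : P) = mu 1 ^ (3 * (n / 3) + n % 3) := by
      rw [mu_pow, mul_one, ← h]; rfl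
    rw [this]
    simp only [mon, ww, map_mul, map_pow, HahnSeries.ofPowerSeries_C]
    change _ = _ * (cc pA ^ _ * U ^ _)
    simp only [lB, lD]
    ring
  · have : HahnSeries.single (deg (Sum.inr k)) (1 : P) = mu (-1) ^ (k + 1) := by
      rw [mu_pow]; simp [mu, deg]
    rw [this]
    simp only [mon, ww, map_pow, HahnSeries.ofPowerSeries_C]
    change _ = _ * cc pq ^ _
    simp only [lC]
    ring

lemma phi_inj (x : MvPolynomial (Fin 5) ℂ ⧸ I_T) (hx : phi x = 0) : x = 0 := by
  obtain ⟨c, rfl⟩ := span_R x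
  have hmon : ∀ i, phi (mon (rr 1) (rr 2) (rr 3) i) = mon lB lC lD i := by
    rintro (n | k) <;> simp [mon, phi_rr1, phi_rr2, phi_rr3]
  have : c = 0 := by
    refine indep deg deg_inj (mon lB lC lD) ww mon_eq ww_ne c ?_
    rw [← hx, Finsupp.sum, Finsupp.sum, map_sum]
    refine Finset.sum_congr rfl fun i _ => ?_
    rw [map_mul, hmon, phi_psi]; rfl
  simp [this]

end FlatAux

open FlatAux in
/-- `R = ℂ[A,B,C,D,T]/I_T` is flat as a module over `ℂ[T]` via the natural
map `T ↦` class of `T`. -/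
theorem stmt_12 :
    Module.Flat (Polynomial ℂ) (MvPolynomial (Fin 5) ℂ ⧸ I_T) := by
  rw [IsDedekindDomain.flat_iff_torsion_eq_bot, ← Submodule.isTorsionFree_iff_torsion_eq_bot,
    Module.isTorsionFree_iff_smul_eq_zero]
  intro f x h
  have hf : f • x = psi (Polynomial.C f) * x := by
    rw [Algebra.smul_def]
    congr 1
    change Polynomial.aeval (Ideal.Quotient.mk I_T (X 4)) f = _
    simp [psi, Polynomial.aeval_def]
    rfl
  rw [hf] at h
  have h2 := congrArg phi h
  rw [map_mul, phi_psi, map_zero] at h2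
  rcases mul_eq_zero.1 h2 with h3 | h3
  · left
    have : Polynomial.C f = 0 := HahnSeries.C_injective (h3.trans (map_zero cc).symm)
    simpa using this
  · right; exact phi_inj x h3
end

section
/- The ring 𝓡 = ℂ[s,A,B,C,D,E]/I_{sE} is a normal domain; that is, 𝓡 is an integral domain that is integrally closed in its field of fractions. -/
open MvPolynomial

/-- Variables: `s = X 0`, `A = X 1`, `B = X 2`, `C = X 3`, `D = X 4`, `E = X 5`. -/
noncomputable def n₁ : MvPolynomial (Fin 6) ℂ :=
  ((X 1) ^ 2 + (X 0) ^ 5 * (X 5) ^ 5) * (X 1) ^ 2 - X 2 * X 3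

noncomputable def n₂ : MvPolynomial (Fin 6) ℂ :=
  ((X 1) ^ 2 + (X 0) ^ 5 * (X 5) ^ 5) * ((X 2) ^ 2 - X 4) - X 3 * X 4

noncomputable def n₃ : MvPolynomial (Fin 6) ℂ :=
  X 2 * ((X 2) ^ 2 - X 4) - (X 1) ^ 2 * X 4

/-- The ideal generated by the three 2×2 minors of
`[[A² + s⁵E⁵, B, D], [C, A², B² − D]]`. -/
noncomputable def I_sE : Ideal (MvPolynomial (Fin 6) ℂ) :=
  Ideal.span {n₁, n₂, n₃}

noncomputable section
namespace SE
abbrev Rr := MvPolynomial (Fin 6) ℂ ⧸ I_sE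
abbrev P4 := MvPolynomial (Fin 4) ℂ

def g (i : Fin 6) : Rr := Ideal.Quotient.mk I_sE (X i)

lemma rel1 : (g 1 ^ 2 + g 0 ^ 5 * g 5 ^ 5) * g 1 ^ 2 = g 2 * g 3 := by
  have h : Ideal.Quotient.mk I_sE n₁ = 0 :=
    Ideal.Quotient.eq_zero_iff_mem.mpr (Ideal.subset_span (by simp))
  simp only [n₁, map_sub, map_mul, map_add, map_pow] at h
  exact sub_eq_zero.mp h

lemma rel2 : (g 1 ^ 2 + g 0 ^ 5 * g 5 ^ 5) * (g 2 ^ 2 - g 4) = g 3 * g 4 := by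
  have h : Ideal.Quotient.mk I_sE n₂ = 0 :=
    Ideal.Quotient.eq_zero_iff_mem.mpr (Ideal.subset_span (by simp))
  simp only [n₂, map_sub, map_mul, map_add, map_pow] at h
  exact sub_eq_zero.mp h

lemma rel3 : g 2 * (g 2 ^ 2 - g 4) = g 1 ^ 2 * g 4 := by
  have h : Ideal.Quotient.mk I_sE n₃ = 0 :=
    Ideal.Quotient.eq_zero_iff_mem.mpr (Ideal.subset_span (by simp))
  simp only [n₃, map_sub, map_mul, map_pow] at h
  exact sub_eq_zero.mp h

/-- homs out of the quotient -/
def lift6 {L : Type} [CommRing L] [Algebra ℂ L] (s a b c d e : L)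
    (h1 : (a ^ 2 + s ^ 5 * e ^ 5) * a ^ 2 = b * c)
    (h2 : (a ^ 2 + s ^ 5 * e ^ 5) * (b ^ 2 - d) = c * d)
    (h3 : b * (b ^ 2 - d) = a ^ 2 * d) : Rr →ₐ[ℂ] L :=
  Ideal.Quotient.liftₐ I_sE (aeval ![s, a, b, c, d, e]) (by
    intro x hx
    have : I_sE ≤ RingHom.ker
        (aeval ![s, a, b, c, d, e] : MvPolynomial (Fin 6) ℂ →ₐ[ℂ] L) := by
      rw [I_sE, Ideal.span_le]
      rintro x (rfl | rfl | rfl)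
      · simp [RingHom.mem_ker, n₁, h1]
      · simp [RingHom.mem_ker, n₂, h2]
      · simp [RingHom.mem_ker, n₃, h3]
    exact this hx)

lemma lift6_g {L : Type} [CommRing L] [Algebra ℂ L] (s a b c d e : L) (h1 h2 h3) (i : Fin 6) :
    lift6 s a b c d e h1 h2 h3 (g i) = ![s, a, b, c, d, e] i := by
  have : lift6 s a b c d e h1 h2 h3 (g i) =
    aeval ![s, a, b, c, d, e] (X i : MvPolynomial (Fin 6) ℂ) := rfl
  rw [this, aeval_X]

lemma Rr_induction {p : Rr → Prop} (r : Rr) (hC : ∀ c : ℂ, p (algebraMap ℂ Rr c))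
    (hadd : ∀ a b, p a → p b → p (a + b)) (hmul : ∀ a i, p a → p (a * g i)) : p r := by
  obtain ⟨r, rfl⟩ := Ideal.Quotient.mk_surjective r
  induction r using MvPolynomial.induction_on with
  | C a => exact hC a
  | add a b ha hb => rw [map_add]; exact hadd _ _ ha hb
  | mul_X a i ha => rw [map_mul]; exact hmul _ _ ha

/-- denominators -/
lemma clear (ι : P4 →ₐ[ℂ] Rr) (f : P4)
    (h : ∀ i, ∃ n p, ι f ^ n * g i = ι p) (r : Rr) : ∃ n p, ι f ^ n * r = ι p := by
  induction r using Rr_induction with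
  | hC c => exact ⟨0, algebraMap ℂ _ c, by simp⟩
  | hadd a b ha hb =>
    obtain ⟨n, p, hp⟩ := ha
    obtain ⟨m, q, hq⟩ := hb
    refine ⟨n + m, f ^ m * p + f ^ n * q, ?_⟩
    simp only [map_add, map_mul, map_pow, ← hp, ← hq]; ring
  | hmul a i ha =>
    obtain ⟨n, p, hp⟩ := ha
    obtain ⟨m, q, hq⟩ := h i
    refine ⟨n + m, p * q, ?_⟩
    simp only [map_mul, ← hp, ← hq]; ring

lemma chart {P R K : Type} [CommRing P] [IsDomain P] [IsIntegrallyClosed P]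
    [CommRing R] [IsDomain R] [Field K] [Algebra R K] [IsFractionRing R K]
    (ι : P →+* R) (hι : Function.Injective ι) (f : P) (hf : ι f ≠ 0)
    (hc : ∀ r, ∃ n p, ι f ^ n * r = ι p) (z : K) (hz : IsIntegral R z) :
    ∃ n : ℕ, ∃ y : R, algebraMap R K (ι f ^ n) * z = algebraMap R K y := by
  let _ : Algebra P K := ((algebraMap R K).comp ι).toAlgebra
  have hmap : ∀ p, algebraMap P K p = algebraMap R K (ι p) := fun p => rfl
  have hRK := IsFractionRing.injective R K
  have hPK : Function.Injective (algebraMap P K) := hRK.comp hι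
  have : IsFractionRing P K := by
    have : FaithfulSMul P K := (faithfulSMul_iff_algebraMap_injective P K).mpr hPK
    refine IsFractionRing.of_field P K (fun z => ?_)
    obtain ⟨a, b, hb, rfl⟩ := IsFractionRing.div_surjective (A := R) z
    obtain ⟨n, p, hp⟩ := hc a
    obtain ⟨m, q, hq⟩ := hc b
    have hb0 : algebraMap R K b ≠ 0 := by
      simpa using nonZeroDivisors.ne_zero hb
    have hf0 : algebraMap R K (ι f) ≠ 0 := by simpa using hf
    refine ⟨f ^ m * p, f ^ n * q, ?_⟩
    simp only [hmap, map_mul, map_pow, ← hp, ← hq]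
    field_simp
  obtain ⟨p, hp, hpz⟩ := hz
  choose N q hq using hc
  let k := ∑ i ∈ Finset.range (p.natDegree + 1), N (p.coeff i)
  have hl : Polynomial.scaleRoots p (ι f ^ k) ∈ Polynomial.lifts ι := by
    rw [Polynomial.lifts_iff_coeff_lifts]
    intro i
    rw [Polynomial.coeff_scaleRoots]
    rcases lt_trichotomy i p.natDegree with h | h | h
    · obtain ⟨j, hj⟩ := Nat.exists_eq_add_of_lt h
      have : p.natDegree - i = j + 1 := by omega
      rw [this]
      have hk : N (p.coeff i) ≤ k :=
        Finset.single_le_sum (f := fun i => N (p.coeff i)) (fun _ _ => Nat.zero_le _)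
          (Finset.mem_range.mpr (by omega))
      obtain ⟨l, hl⟩ := Nat.exists_eq_add_of_le hk
      refine ⟨q (p.coeff i) * f ^ l * (f ^ k) ^ j, ?_⟩
      simp only [map_mul, map_pow, ← hq]
      rw [pow_succ, hl, pow_add]; ring
    · subst h
      exact ⟨1, by simp [hp.coeff_natDegree]⟩
    · exact ⟨0, by simp [Polynomial.coeff_eq_zero_of_natDegree_lt h]⟩
  obtain ⟨Q, hQ, -, hQm⟩ := Polynomial.lifts_and_natDegree_eq_and_monic hl
    ((Polynomial.monic_scaleRoots_iff _).mpr hp)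
  have hint : IsIntegral P (algebraMap R K (ι f ^ k) * z) := by
    refine ⟨Q, hQm, ?_⟩
    have := Polynomial.scaleRoots_eval₂_eq_zero (p := p) (algebraMap R K) (s := ι f ^ k) hpz
    rw [← hQ, Polynomial.eval₂_map] at this
    exact this
  obtain ⟨y, hy⟩ := IsIntegrallyClosed.isIntegral_iff.mp hint
  exact ⟨k, ι y, hy.symm⟩
end SE
end

noncomputable section
namespace SE
section op
variable {Q : Type} [CommRing Q] (T c d : Q)

def opA : Module.End Q (Fin 10 → Q) where
  toFun v := ![(T + c) * d * v 9, v 0, v 1 - T * v 3 + d * v 9, v 2, c * v 3, v 4,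
    v 5 - T * v 7, v 6, c * v 7 - T * v 9, v 8]
  map_add' u v := by ext i; fin_cases i <;> simp <;> ring
  map_smul' u v := by ext i; fin_cases i <;> simp <;> ring

def opB : Module.End Q (Fin 10 → Q) where
  toFun v := ![(T + c) * d * v 6, (T + c) * d * v 7, d * v 6 + d * v 8, d * v 7 + d * v 9,
    v 0 + d * v 8, v 1 + d * v 9, v 2, v 3, v 4 - T * v 6, v 5 - T * v 7]
  map_add' u v := by ext i; fin_cases i <;> simp <;> ring
  map_smul' u v := by ext i; fin_cases i <;> simp <;> ring

lemma opA_apply (v : Fin 10 → Q) : opA T c d v = ![(T + c) * d * v 9, v 0, v 1 - T * v 3 + d * v 9, v 2, c * v 3, v 4,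
    v 5 - T * v 7, v 6, c * v 7 - T * v 9, v 8] := rfl

lemma opB_apply (v : Fin 10 → Q) : opB T c d v = ![(T + c) * d * v 6, (T + c) * d * v 7, d * v 6 + d * v 8, d * v 7 + d * v 9,
    v 0 + d * v 8, v 1 + d * v 9, v 2, v 3, v 4 - T * v 6, v 5 - T * v 7] := rfl

lemma op_comm : opA T c d * opB T c d = opB T c d * opA T c d := by
  refine LinearMap.ext fun v => ?_
  rw [Module.End.mul_apply, Module.End.mul_apply]
  ext i
  fin_cases i <;> simp [opA_apply, opB_apply] <;> ring

abbrev Sub : Subalgebra Q (Module.End Q (Fin 10 → Q)) :=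
  Algebra.adjoin Q {opA T c d, opB T c d}

instance instMC : IsMulCommutative (Sub T c d) := Algebra.isMulCommutative_adjoin Q (by
  rintro a (rfl | rfl) b (rfl | rfl)
  · rfl
  · exact op_comm T c d
  · exact (op_comm T c d).symm
  · rfl)

def sA : Sub T c d := ⟨opA T c d, Algebra.subset_adjoin (by simp)⟩
def sB : Sub T c d := ⟨opB T c d, Algebra.subset_adjoin (by simp)⟩
def sQ (q : Q) : Sub T c d := ⟨algebraMap Q _ q, Subalgebra.algebraMap_mem _ q⟩
end op

end SE
end

noncomputable section
namespace SE
abbrev tT : P4 := X 0 ^ 5 * X 1 ^ 5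
def S4 : Type := Sub tT (X 2 : P4) (X 3)
instance instS4r : Ring S4 := inferInstanceAs (Ring (Sub tT (X 2 : P4) (X 3)))
instance instS4 : CommRing S4 :=
  { instS4r with mul_comm := (instMC tT (X 2 : P4) (X 3)).is_comm.comm }

def ev (q : S4) : Module.End P4 (Fin 10 → P4) := Subtype.val (p := fun x => x ∈ Sub tT (X 2 : P4) (X 3)) q
def tA : S4 := sA tT (X 2 : P4) (X 3)
def tB : S4 := sB tT (X 2 : P4) (X 3)

def tQ : P4 →+* S4 where
  toFun q := sQ tT (X 2 : P4) (X 3) q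
  map_one' := Subtype.ext (map_one _)
  map_mul' a b := Subtype.ext (map_mul _ _ _)
  map_zero' := Subtype.ext (map_zero _)
  map_add' a b := Subtype.ext (map_add _ _ _)

instance instAlgS4 : Algebra ℂ S4 := (tQ.comp MvPolynomial.C).toAlgebra

lemma ev_mul (a b : S4) (v) : ev (a * b) v = ev a (ev b v) := rfl
lemma ev_add (a b : S4) (v) : ev (a + b) v = ev a v + ev b v := rfl
lemma ev_sub (a b : S4) (v) : ev (a - b) v = ev a v - ev b v := rfl
lemma ev_sA (v) : ev tA v = opA tT (X 2 : P4) (X 3) v := rfl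
lemma ev_sB (v) : ev tB v = opB tT (X 2 : P4) (X 3) v := rfl
lemma ev_sQ (q : P4) (v) : ev (tQ q) v = q • v := rfl
lemma ev_ext {a b : S4} (h : ∀ v, ev a v = ev b v) : a = b := Subtype.ext (LinearMap.ext h)
lemma algMap (c : ℂ) : algebraMap ℂ S4 c = tQ (MvPolynomial.C c) := rfl
lemma ev_algebraMap (c : ℂ) (v) : ev (algebraMap ℂ S4 c) v = (MvPolynomial.C c : P4) • v := rfl

lemma r1 : (tA ^ 2 + tQ (X 0) ^ 5 * tQ (X 1) ^ 5) * tA ^ 2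
    = tB * tQ (X 2) := by
  rw [← map_pow, ← map_pow, ← map_mul, pow_two]
  refine ev_ext fun v => ?_
  simp only [ev_mul, ev_add, ev_sub, ev_sA, ev_sB, ev_sQ, map_sub, map_smul]
  ext1 i
  simp only [Pi.sub_apply, Pi.add_apply, Pi.smul_apply, smul_eq_mul]
  fin_cases i <;> simp [opA_apply, opB_apply] <;> ring

lemma r2 : (tA ^ 2 + tQ (X 0) ^ 5 * tQ (X 1) ^ 5) *
    (tB ^ 2 - tQ (X 3)) = tQ (X 2) * tQ (X 3) := by
  rw [← map_pow, ← map_pow, ← map_mul, pow_two, pow_two]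
  refine ev_ext fun v => ?_
  simp only [ev_mul, ev_add, ev_sub, ev_sA, ev_sB, ev_sQ, map_sub, map_smul]
  ext1 i
  simp only [Pi.sub_apply, Pi.add_apply, Pi.smul_apply, smul_eq_mul]
  fin_cases i <;> simp [opA_apply, opB_apply] <;> ring

lemma r3 : tB * (tB ^ 2 - tQ (X 3)) =
    tA ^ 2 * tQ (X 3) := by
  rw [pow_two, pow_two]
  refine ev_ext fun v => ?_
  simp only [ev_mul, ev_add, ev_sub, ev_sA, ev_sB, ev_sQ, map_sub, map_smul]
  ext1 i
  simp only [Pi.sub_apply, Pi.add_apply, Pi.smul_apply, smul_eq_mul]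
  fin_cases i <;> simp [opA_apply, opB_apply] <;> ring

def psi : Rr →ₐ[ℂ] S4 :=
  lift6 (tQ (X 0)) (tA) (tB) (tQ (X 2)) (tQ (X 3)) (tQ (X 1))
    r1 r2 r3

def jj : P4 →ₐ[ℂ] Rr := aeval ![g 0, g 5, g 3, g 4]

lemma jj0 : jj (X 0) = g 0 := by simp [jj]
lemma jj1 : jj (X 1) = g 5 := by simp [jj]
lemma jj2 : jj (X 2) = g 3 := by simp [jj]
lemma jj3 : jj (X 3) = g 4 := by simp [jj]

lemma psi_jj (q : P4) : psi (jj q) = tQ q := by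
  induction q using MvPolynomial.induction_on with
  | C a =>
    rw [← MvPolynomial.algebraMap_eq, AlgHom.commutes, AlgHom.commutes, algMap]; rfl
  | add a b ha hb => rw [map_add, map_add, ha, hb, map_add]
  | mul_X a i ha =>
    rw [map_mul, map_mul, ha, map_mul]
    congr 1
    fin_cases i <;> simp [jj, psi, lift6_g]

def G (v : Fin 10 → P4) : Rr :=
  jj (v 0) + jj (v 1) * g 1 + jj (v 2) * g 1 ^ 2 + jj (v 3) * g 1 ^ 3
  + jj (v 4) * g 2 + jj (v 5) * (g 1 * g 2) + jj (v 6) * (g 1 ^ 2 * g 2)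
  + jj (v 7) * (g 1 ^ 3 * g 2) + jj (v 8) * g 2 ^ 2 + jj (v 9) * (g 1 * g 2 ^ 2)

lemma G_A (v) : G (opA tT (X 2 : P4) (X 3) v) = G v * g 1 := by
  simp only [G, opA_apply]
  simp [jj0, jj1, jj2, jj3]
  linear_combination (-(jj (v 3)) - jj (v 7) * g 2) * rel1 - jj (v 9) * rel2

lemma G_B (v) : G (opB tT (X 2 : P4) (X 3) v) = G v * g 2 := by
  simp only [G, opB_apply]
  simp [jj0, jj1, jj2, jj3]
  linear_combination (-(jj (v 6)) - jj (v 7) * g 1) * rel2 - (jj (v 8) + jj (v 9) * g 1) * rel3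

lemma G_Q (q : P4) (v) : G (q • v) = G v * jj q := by
  simp [G]; ring

lemma G_add (u v) : G (u + v) = G u + G v := by
  simp [G]; ring

lemma G_psi (r : Rr) : ∀ v, G (ev (psi r) v) = r * G v := by
  induction r using Rr_induction with
  | hC c =>
    intro v
    rw [AlgHom.commutes, ev_algebraMap, G_Q, ← MvPolynomial.algebraMap_eq, AlgHom.commutes,
      mul_comm]
  | hadd a b ha hb =>
    intro v
    rw [map_add, ev_add, G_add, ha, hb]; ring
  | hmul a i ha =>
    intro v
    rw [map_mul, ev_mul, ha, mul_assoc]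
    congr 1
    have hg : psi (g i) = ![tQ (X 0), tA, tB, tQ (X 2), tQ (X 3), tQ (X 1)] i :=
      lift6_g _ _ _ _ _ _ _ _ _ _
    rw [hg]
    fin_cases i
    · change G (ev (tQ (X 0)) v) = _
      rw [ev_sQ, G_Q, jj0, mul_comm]; rfl
    · change G (ev tA v) = _
      rw [ev_sA, G_A, mul_comm]; rfl
    · change G (ev tB v) = _
      rw [ev_sB, G_B, mul_comm]; rfl
    · change G (ev (tQ (X 2)) v) = _
      rw [ev_sQ, G_Q, jj2, mul_comm]; rfl
    · change G (ev (tQ (X 3)) v) = _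
      rw [ev_sQ, G_Q, jj3, mul_comm]; rfl
    · change G (ev (tQ (X 1)) v) = _
      rw [ev_sQ, G_Q, jj1, mul_comm]; rfl

def e0 : Fin 10 → P4 := ![1, 0, 0, 0, 0, 0, 0, 0, 0, 0]

lemma G_surj (r : Rr) : ∃ v, r = G v := by
  refine ⟨ev (psi r) e0, ?_⟩
  rw [G_psi]
  simp [G, e0]

lemma N_G (v) : ev (psi (G v)) e0 = v := by
  have h1 : psi (g 1) = tA := lift6_g _ _ _ _ _ _ _ _ _ _
  have h2 : psi (g 2) = tB := lift6_g _ _ _ _ _ _ _ _ _ _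
  simp only [G, map_add, map_mul, map_pow, psi_jj, h1, h2, pow_succ, pow_zero, one_mul]
  simp only [ev_mul, ev_add, ev_sA, ev_sB, ev_sQ]
  ext1 i
  fin_cases i <;> simp [opA_apply, opB_apply, e0]

lemma G_inj {u v} (h : G u = G v) : u = v := by
  rw [← N_G u, h, N_G]

/-- regularity -/
lemma jj_nzd (q : P4) (hq : q ≠ 0) (r : Rr) (h : jj q * r = 0) : r = 0 := by
  obtain ⟨v, rfl⟩ := G_surj r
  have h0 : G 0 = 0 := by simp [G]
  rw [mul_comm, ← G_Q, ← h0] at h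
  have := G_inj h
  have hv : v = 0 := by
    rcases smul_eq_zero.mp this with h | h
    · exact absurd h hq
    · exact h
  rw [hv, h0]

lemma jj_reg (q : P4) (hq : ¬ X 3 ∣ q) (m : ℕ) (x y : Rr) (h : jj q * x = g 4 ^ m * y) :
    ∃ w, x = g 4 ^ m * w := by
  obtain ⟨u, rfl⟩ := G_surj x
  obtain ⟨v, rfl⟩ := G_surj y
  have hg : g 4 ^ m = jj (X 3 ^ m) := by simp [jj]
  rw [hg, mul_comm, ← G_Q, mul_comm, ← G_Q] at h
  have h := G_inj h
  have : ∀ i, ∃ w, u i = X 3 ^ m * w := fun i => by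
    have hi := congrFun h i
    exact (X_prime (R := ℂ) (i := (3 : Fin 4))).pow_dvd_of_dvd_mul_left m hq
      ⟨v i, by simpa using hi⟩
  choose w hw using this
  refine ⟨G w, ?_⟩
  rw [hg, mul_comm, ← G_Q]
  congr 1
  ext1 i
  simp [hw]
end SE
end

noncomputable section
namespace SE

lemma inj_of {w : Fin 4 → Rr} (φ : Rr →ₐ[ℂ] FractionRing P4)
    (h : ∀ i, φ (w i) = algebraMap P4 _ (X i)) :
    Function.Injective (aeval w : P4 →ₐ[ℂ] Rr) := by
  have hc : φ.comp (aeval w) = IsScalarTower.toAlgHom ℂ P4 (FractionRing P4) := by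
    refine MvPolynomial.algHom_ext fun i => ?_
    simp [h]
  intro a b hab
  apply IsFractionRing.injective P4 (FractionRing P4)
  have := DFunLike.congr_fun hc
  have ha := this a
  have hb := this b
  simp only [AlgHom.comp_apply, IsScalarTower.coe_toAlgHom'] at ha hb
  rw [← ha, ← hb, hab]

lemma frac_ne {p : P4} (v : Fin 4 → ℂ) (h : eval v p ≠ 0) :
    algebraMap P4 (FractionRing P4) p ≠ 0 := by
  have : p ≠ 0 := by rintro rfl; simp at h
  simpa using this

/-! three charts -/
def i1 : P4 →ₐ[ℂ] Rr := aeval ![g 0, g 5, g 1, g 3]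
def i2 : P4 →ₐ[ℂ] Rr := aeval ![g 0, g 5, g 1, g 2]
def i3 : P4 →ₐ[ℂ] Rr := aeval ![g 0, g 5, g 1, g 4 - g 1 ^ 4 + g 1 ^ 2 * g 2 - g 2 ^ 2]

def pp : P4 := X 2 ^ 2 + X 0 ^ 5 * X 1 ^ 5
def f1 : P4 := X 3 * (X 3 + pp)
def f2 : P4 := (X 2 ^ 2 + X 3) * X 3
def be : P4 := - (X 2 ^ 6 + X 2 ^ 2 * X 3)
def de : P4 := X 3 ^ 3 + X 2 ^ 4 * X 3 ^ 2 - X 2 ^ 2 * be * X 3 + be ^ 2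
def f3 : P4 := X 3 * de

abbrev xx (i : Fin 4) : FractionRing P4 := algebraMap P4 _ (X i)

lemma i1_inj : Function.Injective i1 := by
  have h3 : xx 3 ≠ 0 := frac_ne ![0, 0, 0, 1] (by simp)
  have h4 : xx 3 + (xx 2 ^ 2 + xx 0 ^ 5 * xx 1 ^ 5) ≠ 0 := by
    have := frac_ne (p := X 3 + (X 2 ^ 2 + X 0 ^ 5 * X 1 ^ 5)) ![0, 0, 0, 1] (by simp)
    simpa using this
  generalize hs : xx 0 = s at *
  generalize he : xx 1 = e at *
  generalize ha : xx 2 = a at *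
  generalize hc : xx 3 = c at *
  refine inj_of (lift6 s a ((a ^ 2 + s ^ 5 * e ^ 5) * a ^ 2 / c) c
    ((a ^ 2 + s ^ 5 * e ^ 5) * ((a ^ 2 + s ^ 5 * e ^ 5) * a ^ 2 / c) ^ 2 /
      (c + (a ^ 2 + s ^ 5 * e ^ 5))) e ?_ ?_ ?_) ?_
  · field_simp
  · field_simp; ring
  · field_simp; ring
  · intro i
    fin_cases i <;> simp [lift6_g, ← hs, ← he, ← ha, ← hc]

lemma i2_inj : Function.Injective i2 := by
  have h3 : xx 3 ≠ 0 := frac_ne ![0, 0, 0, 1] (by simp)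
  have h4 : xx 2 ^ 2 + xx 3 ≠ 0 := by
    have := frac_ne (p := X 2 ^ 2 + X 3) ![0, 0, 0, 1] (by simp)
    simpa using this
  generalize hs : xx 0 = s at *
  generalize he : xx 1 = e at *
  generalize ha : xx 2 = a at *
  generalize hc : xx 3 = b at *
  refine inj_of (lift6 s a b ((a ^ 2 + s ^ 5 * e ^ 5) * a ^ 2 / b)
    (b ^ 3 / (a ^ 2 + b)) e ?_ ?_ ?_) ?_
  · field_simp
  · field_simp; ring
  · field_simp; ring
  · intro i
    fin_cases i <;> simp [lift6_g, ← hs, ← he, ← ha, ← hc]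

lemma i3_inj : Function.Injective i3 := by
  have h3 : xx 3 ≠ 0 := frac_ne ![0, 0, 0, 1] (by simp)
  have h4 : xx 3 ^ 3 + xx 2 ^ 4 * xx 3 ^ 2 - xx 2 ^ 2 * (- (xx 2 ^ 6 + xx 2 ^ 2 * xx 3)) * xx 3
      + (- (xx 2 ^ 6 + xx 2 ^ 2 * xx 3)) ^ 2 ≠ 0 := by
    have := frac_ne (p := de) ![0, 0, 0, 1] (by simp [de, be])
    simpa [de, be] using this
  generalize hs : xx 0 = s at *
  generalize he : xx 1 = e at *
  generalize ha : xx 2 = a at *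
  generalize hc : xx 3 = y at *
  obtain ⟨b, hb⟩ : ∃ b, b = - (a ^ 6 + a ^ 2 * y) / y := ⟨_, rfl⟩
  obtain ⟨d, hd⟩ : ∃ d, d = y + a ^ 4 - a ^ 2 * b + b ^ 2 := ⟨_, rfl⟩
  have hyb : y * b = - (a ^ 6 + a ^ 2 * y) := by rw [hb]; field_simp
  have hd0 : d ≠ 0 := by
    intro h
    apply h4
    rw [← hyb]
    rw [hd] at h
    linear_combination y ^ 2 * h
  have hr3 : b * (b ^ 2 - d) = a ^ 2 * d := by
    rw [hd]; linear_combination - hyb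
  refine inj_of (lift6 s a b ((a ^ 2 + s ^ 5 * e ^ 5) * (b ^ 2 - d) / d) d e ?_ ?_ hr3) ?_
  · field_simp
    linear_combination - (a ^ 2 + s ^ 5 * e ^ 5) * hr3
  · field_simp
  · intro i
    fin_cases i
    · simp [lift6_g, ← hs]
    · simp [lift6_g, ← he]
    · simp [lift6_g, ← ha]
    · simp [lift6_g, ← hc]
      rw [hd, ← hc]; ring

lemma c1 : ∀ i, ∃ n p, i1 f1 ^ n * g i = i1 p := by
  have hf : i1 f1 = g 3 * (g 3 + (g 1 ^ 2 + g 0 ^ 5 * g 5 ^ 5)) := by simp [i1, f1, pp]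
  intro i
  fin_cases i
  · exact ⟨0, X 0, by simp [i1]⟩
  · exact ⟨0, X 2, by simp [i1]⟩
  · refine ⟨1, (X 3 + pp) * pp * X 2 ^ 2, ?_⟩
    rw [hf]; simp [i1, pp]
    linear_combination - (g 3 + (g 1 ^ 2 + g 0 ^ 5 * g 5 ^ 5)) * rel1
  · exact ⟨0, X 3, by simp [i1]⟩
  · refine ⟨2, (X 3 + pp) * pp ^ 3 * X 2 ^ 4, ?_⟩
    rw [hf]; simp [i1, pp]
    linear_combination - g 3 ^ 2 * (g 3 + (g 1 ^ 2 + g 0 ^ 5 * g 5 ^ 5)) * rel2 -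
      (g 3 + (g 1 ^ 2 + g 0 ^ 5 * g 5 ^ 5)) * (g 1 ^ 2 + g 0 ^ 5 * g 5 ^ 5) *
      ((g 1 ^ 2 + g 0 ^ 5 * g 5 ^ 5) * g 1 ^ 2 + g 2 * g 3) * rel1
  · exact ⟨0, X 1, by simp [i1]⟩

lemma c2 : ∀ i, ∃ n p, i2 f2 ^ n * g i = i2 p := by
  have hf : i2 f2 = (g 1 ^ 2 + g 2) * g 2 := by simp [i2, f2]
  intro i
  fin_cases i
  · exact ⟨0, X 0, by simp [i2]⟩
  · exact ⟨0, X 2, by simp [i2]⟩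
  · exact ⟨0, X 3, by simp [i2]⟩
  · refine ⟨1, (X 2 ^ 2 + X 3) * pp * X 2 ^ 2, ?_⟩
    rw [hf]; simp [i2, pp]
    linear_combination - (g 1 ^ 2 + g 2) * rel1
  · refine ⟨1, X 3 ^ 4, ?_⟩
    rw [hf]; simp [i2]
    linear_combination - g 2 * rel3
  · exact ⟨0, X 1, by simp [i2]⟩

lemma key3 : i3 (X 3) * g 2 = i3 be := by
  simp [i3, be]
  linear_combination - rel3

lemma key3d : i3 (X 3) ^ 2 * g 4 = i3 de := by
  have h : i3 de = i3 (X 3) ^ 3 + g 1 ^ 4 * i3 (X 3) ^ 2 - g 1 ^ 2 * i3 be * i3 (X 3) + i3 be ^ 2 := by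
    simp [i3, de]
  have hy : g 4 = i3 (X 3) + g 1 ^ 4 - g 1 ^ 2 * g 2 + g 2 ^ 2 := by simp [i3]; ring
  rw [h, ← key3]
  linear_combination i3 (X 3) ^ 2 * hy

lemma c3 : ∀ i, ∃ n p, i3 f3 ^ n * g i = i3 p := by
  have hf : i3 f3 = i3 (X 3) * i3 de := by simp [f3]
  intro i
  fin_cases i
  · exact ⟨0, X 0, by simp [i3]⟩
  · exact ⟨0, X 2, by simp [i3]⟩
  · refine ⟨1, de * be, ?_⟩
    change _ * g 2 = _
    rw [hf, map_mul, ← key3]; ring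
  · refine ⟨1, pp * (X 3 * be ^ 2 - X 3 * de), ?_⟩
    change _ * g 3 = _
    have hp : i3 pp = g 1 ^ 2 + g 0 ^ 5 * g 5 ^ 5 := by simp [i3, pp]
    rw [hf, map_mul, map_sub, map_mul, map_mul, map_pow, ← key3, ← key3d, hp]
    linear_combination - i3 (X 3) ^ 3 * rel2
  · refine ⟨2, de ^ 3, ?_⟩
    change _ * g 4 = _
    rw [hf, map_pow]
    linear_combination i3 de ^ 2 * key3d
  · exact ⟨0, X 1, by simp [i3]⟩

def qq : P4 := X 2 ^ 4 * (X 2 + X 0 ^ 5 * X 1 ^ 5) ^ 2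

lemma qq_ndvd : ¬ X 3 ∣ qq := by
  rintro ⟨w, hw⟩
  have := congrArg (eval ![0, 0, 1, 0]) hw
  simp [qq] at this

lemma qq_eq : ∃ w, jj qq = i1 f1 * w := by
  have hf : i1 f1 = g 3 * (g 3 + (g 1 ^ 2 + g 0 ^ 5 * g 5 ^ 5)) := by simp [i1, f1, pp]
  have hq : jj qq = g 3 ^ 4 * (g 3 + g 0 ^ 5 * g 5 ^ 5) ^ 2 := by simp [jj, qq]
  have h1 := rel1
  have h2 := rel2
  rw [hf, hq]
  generalize g 0 ^ 5 * g 5 ^ 5 = T at *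
  refine ⟨((g 1 ^ 2 + T) ^ 2 - (g 1 ^ 2 + T) * g 3 + g 3 ^ 2) * g 1 ^ 4
    + g 3 ^ 3 * (g 3 + T - g 1 ^ 2) - g 3 ^ 2 * g 4, ?_⟩
  linear_combination - g 3 ^ 3 * h2 - g 3 * (g 1 ^ 2 + T) *
    ((g 1 ^ 2 + T) * g 1 ^ 2 + g 2 * g 3) * h1

lemma f1_nzd (r : Rr) (h : i1 f1 * r = 0) : r = 0 := by
  obtain ⟨w, hw⟩ := qq_eq
  refine jj_nzd qq (fun h => qq_ndvd (by simp [h])) r ?_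
  rw [hw]; linear_combination w * h

lemma dom : IsDomain Rr := by
  have hnt : Nontrivial Rr := i1_inj.nontrivial
  have hp : ∀ (n : ℕ) r, i1 f1 ^ n * r = 0 → r = 0 := by
    intro n
    induction n with
    | zero => intro r h; simpa using h
    | succ n ih =>
      intro r h
      exact f1_nzd r (ih _ (by rw [← mul_assoc, ← pow_succ]; exact h))
  have : NoZeroDivisors Rr := ⟨by
    intro a b hab
    obtain ⟨n, p, hn⟩ := clear i1 f1 c1 a
    obtain ⟨m, q, hm⟩ := clear i1 f1 c1 b
    have : i1 (p * q) = i1 0 := by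
      rw [map_mul, ← hn, ← hm, map_zero]
      linear_combination i1 f1 ^ n * i1 f1 ^ m * hab
    rcases mul_eq_zero.mp (i1_inj this) with h | h
    · left; apply hp n; rw [hn, h, map_zero]
    · right; apply hp m; rw [hm, h, map_zero]⟩
  exact NoZeroDivisors.to_isDomain _

lemma frac_ne' {p : P4} (v : Fin 4 → ℂ) (h : eval v p ≠ 0) (ι : P4 →ₐ[ℂ] Rr)
    (hι : Function.Injective ι) : ι p ≠ 0 := by
  intro h0
  have : p = 0 := hι (by rw [h0, map_zero])
  exact h (by simp [this])

lemma normal : IsIntegrallyClosed Rr := by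
  have := dom
  have hint : IsIntegrallyClosed P4 := inferInstance
  rw [isIntegrallyClosed_iff (FractionRing Rr)]
  intro z hz
  obtain ⟨J, hJ⟩ : ∃ J : Ideal Rr, ∀ r, r ∈ J ↔
      ∃ y, algebraMap Rr (FractionRing Rr) r * z = algebraMap Rr (FractionRing Rr) y := by
    refine ⟨⟨⟨⟨{r | ∃ y, algebraMap Rr (FractionRing Rr) r * z = algebraMap Rr (FractionRing Rr) y},
      ?_⟩, ?_⟩, ?_⟩, fun r => Iff.rfl⟩
    · rintro a b ⟨y, hy⟩ ⟨y', hy'⟩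
      exact ⟨y + y', by rw [map_add, map_add, add_mul, hy, hy']⟩
    · exact ⟨0, by simp⟩
    · rintro c a ⟨y, hy⟩
      exact ⟨c * y, by rw [smul_eq_mul, map_mul, map_mul, mul_assoc, hy]⟩
  have ch : ∀ (ι : P4 →ₐ[ℂ] Rr) (f : P4), Function.Injective ι → ι f ≠ 0 →
      (∀ i, ∃ n p, ι f ^ n * g i = ι p) → ι f ∈ J.radical := by
    intro ι f h1 h2 h3
    obtain ⟨n, hn⟩ := chart (K := FractionRing Rr) ι.toRingHom h1 f h2 (clear ι f h3) z hz
    exact ⟨n, (hJ _).mpr hn⟩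
  have m1 := ch i1 f1 i1_inj
    (frac_ne' ![0, 0, 0, 1] (by simp [f1, pp]) i1 i1_inj) c1
  have m2 := ch i2 f2 i2_inj
    (frac_ne' ![0, 0, 0, 1] (by simp [f2]) i2 i2_inj) c2
  have m3 := ch i3 f3 i3_inj
    (frac_ne' ![0, 0, 0, 1] (by simp [f3, de, be]) i3 i3_inj) c3
  have hrad : ∀ x (n : ℕ), x ^ n ∈ J.radical → x ∈ J.radical := fun x n h =>
    (Ideal.radical_isRadical J) ⟨n, h⟩
  have hFD : (g 1 ^ 2 + g 2) * g 4 ∈ J.radical := by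
    apply hrad _ 2
    have hf : i2 f2 = (g 1 ^ 2 + g 2) * g 2 := by simp [i2, f2]
    have h := Ideal.mul_mem_left J.radical (g 2 ^ 2 * g 4) m2
    have e : ((g 1 ^ 2 + g 2) * g 4) ^ 2 = g 2 ^ 2 * g 4 * i2 f2 := by
      rw [hf]; linear_combination - (g 1 ^ 2 + g 2) * g 4 * rel3
    rw [e]; exact h
  have hYD : i3 (X 3) * g 4 ∈ J.radical := by
    apply hrad _ 3
    have h := Ideal.mul_mem_left J.radical (g 4 ^ 2) m3
    have e : (i3 (X 3) * g 4) ^ 3 = g 4 ^ 2 * i3 f3 := by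
      rw [f3, map_mul, ← key3d]; ring
    rw [e]; exact h
  have hD : g 4 ∈ J.radical := by
    apply hrad _ 3
    have hy : g 4 = i3 (X 3) + g 1 ^ 4 - g 1 ^ 2 * g 2 + g 2 ^ 2 := by simp [i3]; ring
    have hk : i3 (X 3) * (g 1 ^ 2 + g 2) = - g 1 ^ 6 := by
      have := key3
      simp [i3, be] at this ⊢
      linear_combination this
    -- D = Y + F * (B - 2A²) + 3A⁴
    have hz : g 4 = i3 (X 3) + (g 1 ^ 2 + g 2) * (g 2 - 2 * g 1 ^ 2) + 3 * g 1 ^ 4 := by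
      linear_combination hy
    have e : g 4 ^ 3 = (g 4 + 3 * g 1 ^ 4 - 9 * g 1 ^ 2 * (g 1 ^ 2 + g 2)) * (i3 (X 3) * g 4)
        + (g 4 + 3 * g 1 ^ 4) * (g 2 - 2 * g 1 ^ 2) * ((g 1 ^ 2 + g 2) * g 4) := by
      linear_combination (g 4 ^ 2 + 3 * g 1 ^ 4 * g 4) * hz + 9 * g 1 ^ 2 * g 4 * hk
    rw [e]
    exact add_mem (Ideal.mul_mem_left _ _ hYD) (Ideal.mul_mem_left _ _ hFD)
  have hq : jj qq ∈ J.radical := by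
    obtain ⟨w, hw⟩ := qq_eq
    rw [hw]; exact Ideal.mul_mem_right _ _ m1
  obtain ⟨m, hm⟩ := hD
  obtain ⟨n, hn⟩ := hq
  obtain ⟨x, hx⟩ := (hJ _).mp hm
  obtain ⟨y, hy⟩ := (hJ _).mp hn
  have hRK := IsFractionRing.injective Rr (FractionRing Rr)
  have heq : jj (qq ^ n) * x = g 4 ^ m * y := by
    apply hRK
    rw [map_mul, map_mul, ← hx, ← hy, map_pow jj]; ring
  obtain ⟨w, hw⟩ := jj_reg (qq ^ n)
    (fun h => qq_ndvd ((X_prime (R := ℂ) (i := (3 : Fin 4))).dvd_of_dvd_pow h)) m x y heq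
  refine ⟨w, ?_⟩
  have hg4 : g 4 ^ m ≠ 0 := by
    apply pow_ne_zero
    intro h0
    have := jj_nzd (X 3) (X_ne_zero _) 1 (by rw [jj3, h0, zero_mul])
    exact one_ne_zero this
  have hg4' : algebraMap Rr (FractionRing Rr) (g 4 ^ m) ≠ 0 := by
    intro h0; exact hg4 (hRK (by rw [h0, map_zero]))
  rw [hw, map_mul] at hx
  exact (mul_left_cancel₀ hg4' hx).symm

end SE
end

/-- `𝓡 = ℂ[s,A,B,C,D,E]/I_{sE}` is a normal domain: an integral domain which
is integrally closed in its field of fractions. -/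
theorem stmt_19 :
    IsDomain (MvPolynomial (Fin 6) ℂ ⧸ I_sE) ∧
    IsIntegrallyClosed (MvPolynomial (Fin 6) ℂ ⧸ I_sE) :=
  ⟨SE.dom, SE.normal⟩
end
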